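/- Let T be a Y(1|2) T-family in A, let M be a left A-module with highest weight vector Ω, and let ū = (u₁,…,u_a), v̄ = (v₁,…,v_b) have admissible concatenation. Then the two explicit expressions for the Y(1|2) Bethe vector agree: Σ g(ū_I,v̄_I)·f(v̄_I,v̄_II)·g(ū_II,ū_I)·h(v̄_I,v̄_I)·λ₂(ū_I)·𝕋₁₃(v̄_I)·T₂₃(v̄_II)·𝕋₁₂(ū_II)·Ω = Σ K_ℓ(ū_I|v̄_I)·f(v̄_I,v̄_II)·g(ū_II,ū_I)·λ₂(v̄_I)·𝕋₁₃(ū_I)·𝕋₁₂(ū_II)·T₂₃(v̄_II)·Ω, where both sums run over all partitions ū = ū_I ⊔ ū_II, v̄ = v̄_I ⊔ v̄_II with #ū_I = #v̄_I = ℓ, h(v̄_I,v̄_I) = ∏_{v ≠ v′ ∈ v̄_I} h(v,v′), and λ₂(w̄) = ∏ⱼ λ₂(wⱼ). -/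

import Mathlib

open scoped BigOperators
open MulOpposite

noncomputable section

namespace Bethe

variable {A : Type*} [Ring A] [Algebra ℂ A]

/-- `g(u,v) = c/(u-v)` -/
def gg (c u v : ℂ) : ℂ := c / (u - v)

/-- `f(u,v) = (u-v+c)/(u-v)` -/
def ff (c u v : ℂ) : ℂ := (u - v + c) / (u - v)

/-- `h(u,v) = (u-v+c)/c` -/
def hh (c u v : ℂ) : ℂ := (u - v + c) / c

/-- A list of parameters is admissible if its entries are pairwise distinct and
`x - y + c ≠ 0` for any two distinct entries `x`, `y`. -/
def Admissible (c : ℂ) (l : List ℂ) : Prop :=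
  l.Pairwise fun x y => x ≠ y ∧ x - y + c ≠ 0 ∧ y - x + c ≠ 0

/-- `∏_{x ∈ xs} ∏_{y ∈ ys} f(x,y)` -/
def prodFF (c : ℂ) (xs ys : List ℂ) : ℂ :=
  (xs.map fun x => (ys.map fun y => ff c x y).prod).prod

/-- `∏_{x ∈ xs} ∏_{y ∈ ys} g(x,y)` -/
def prodGG (c : ℂ) (xs ys : List ℂ) : ℂ :=
  (xs.map fun x => (ys.map fun y => gg c x y).prod).prod

/-- `∏_{x ∈ xs} ∏_{y ∈ ys} h(x,y)` -/
def prodHH (c : ℂ) (xs ys : List ℂ) : ℂ :=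
  (xs.map fun x => (ys.map fun y => hh c x y).prod).prod

/-- `H(w̄) = ∏_{j>k} h(wⱼ,wₖ)` -/
def Hnorm (c : ℂ) : List ℂ → ℂ
  | [] => 1
  | x :: xs => ((xs.map fun y => hh c y x).prod) * Hnorm c xs

/-- `H(w̄*) = ∏_{j<k} h(wⱼ,wₖ)` -/
def HnormRev (c : ℂ) : List ℂ → ℂ
  | [] => 1
  | x :: xs => ((xs.map fun y => hh c x y).prod) * HnormRev c xs

/-- product of `h` over ordered pairs of distinct positions of a list -/
def prodHHne (c : ℂ) (xs : List ℂ) : ℂ :=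
  ∏ j : Fin xs.length, ∏ k : Fin xs.length,
    if j ≠ k then hh c (xs.get j) (xs.get k) else 1

/-- ordered product `T(w₁)⋯T(wₙ)` -/
def Tprod (Tij : ℂ → A) (l : List ℂ) : A := (l.map Tij).prod

/-- normalized ordered product `H(w̄)⁻¹ T(w₁)⋯T(wₙ)` -/
def TT (c : ℂ) (Tij : ℂ → A) (l : List ℂ) : A := (Hnorm c l)⁻¹ • Tprod Tij l

/-- normalized ordered product `H(w̄*)⁻¹ T(w₁)⋯T(wₙ)` -/
def TTrev (c : ℂ) (Tij : ℂ → A) (l : List ℂ) : A := (HnormRev c l)⁻¹ • Tprod Tij l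

/-- The defining (RTT) commutation relations of a super-Yangian `T`-family with
`ℤ₂`-grading `p`. -/
def IsTFam (c : ℂ) {N : ℕ} (p : Fin N → ℕ) (T : Fin N → Fin N → ℂ → A) : Prop :=
  ∀ i j k l : Fin N, ∀ z w : ℂ, z ≠ w →
    T i j z * T k l w - ((-1 : ℂ) ^ ((p i + p j) * (p k + p l))) • (T k l w * T i j z)
      = ((-1 : ℂ) ^ (p l * (p i + p j) + p i * p j) * gg c z w) •
          (T i l z * T k j w - T i l w * T k j z)

/-- the distinguished grading of `gl(2|1)`: `[1]=[2]=0`, `[3]=1` -/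
def p21 : Fin 3 → ℕ := ![0, 0, 1]

/-- the distinguished grading of `gl(1|2)`: `[1]=0`, `[2]=[3]=1` -/
def p12 : Fin 3 → ℕ := ![0, 1, 1]

/-- the sublist of `l` given by the positions in `S`, in the inherited order -/
def sel (l : List ℂ) (S : Finset (Fin l.length)) : List ℂ :=
  (S.sort (· ≤ ·)).map l.get

/-- `λ(w̄) = ∏ⱼ λ(wⱼ)` -/
def lamP (lam2 : ℂ → ℂ) (l : List ℂ) : ℂ := (l.map lam2).prod

/-- The Izergin kernel `K_ℓ(v̄|ū)`. -/
def Kiz (c : ℂ) {ℓ : ℕ} (vs us : Fin ℓ → ℂ) : ℂ :=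
  (∏ j : Fin ℓ, ∏ k : Fin ℓ, if (k : ℕ) < (j : ℕ) then gg c (vs j) (vs k) else 1) *
    (∏ j : Fin ℓ, ∏ k : Fin ℓ, if (k : ℕ) < (j : ℕ) then gg c (us k) (us j) else 1) *
    (∏ j : Fin ℓ, ∏ k : Fin ℓ, hh c (vs j) (us k)) *
    Matrix.det (Matrix.of fun j k => gg c (vs j) (us k) / hh c (vs j) (us k))

/-- The Izergin kernel for lists of equal length (and junk value `0` otherwise). -/
def KizL (c : ℂ) (vs us : List ℂ) : ℂ :=
  if h : vs.length = us.length then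
    Kiz c vs.get fun j => us.get (Fin.cast h j)
  else 0

/-- The operator `X_{a,b}(ū,v̄)` of the paper (`Y(2|1)` case). -/
def X (c : ℂ) (T : Fin 3 → Fin 3 → ℂ → A) (u v : List ℂ) : A :=
  ∑ S : Finset (Fin u.length), ∑ Q : Finset (Fin v.length),
    if S.card = Q.card then
      (prodGG c (sel v Q) (sel u S) * prodFF c (sel u S) (sel u Sᶜ) *
          prodGG c (sel v Qᶜ) (sel v Q) * prodHHne c (sel u S)) •
        (TT c (T 0 2) (sel u S) * Tprod (T 0 1) (sel u Sᶜ) *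
          TT c (T 1 2) (sel v Qᶜ) * Tprod (T 1 1) (sel v Q))
    else 0

/-- The operator `Y_{a,b}(ū,v̄)` of the paper (`Y(2|1)` case). -/
def Y (c : ℂ) (T : Fin 3 → Fin 3 → ℂ → A) (u v : List ℂ) : A :=
  ∑ S : Finset (Fin u.length), ∑ Q : Finset (Fin v.length),
    if S.card = Q.card then
      (KizL c (sel v Q) (sel u S) * prodFF c (sel u S) (sel u Sᶜ) *
          prodGG c (sel v Qᶜ) (sel v Q)) •
        (TT c (T 0 2) (sel v Q) * TT c (T 1 2) (sel v Qᶜ) *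
          Tprod (T 0 1) (sel u Sᶜ) * Tprod (T 1 1) (sel u S))
    else 0

/-- First explicit expression for the `Y(2|1)` Bethe vector (operator part,
the weights `λ₂` included as scalars). -/
def PhiA (c : ℂ) (T : Fin 3 → Fin 3 → ℂ → A) (lam2 : ℂ → ℂ) (u v : List ℂ) : A :=
  ∑ S : Finset (Fin u.length), ∑ Q : Finset (Fin v.length),
    if S.card = Q.card then
      (prodGG c (sel v Q) (sel u S) * prodFF c (sel u S) (sel u Sᶜ) *
          prodGG c (sel v Qᶜ) (sel v Q) * prodHHne c (sel u S) * lamP lam2 (sel v Q)) •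
        (TT c (T 0 2) (sel u S) * Tprod (T 0 1) (sel u Sᶜ) * TT c (T 1 2) (sel v Qᶜ))
    else 0

/-- Second explicit expression for the `Y(2|1)` Bethe vector (operator part). -/
def PhiB (c : ℂ) (T : Fin 3 → Fin 3 → ℂ → A) (lam2 : ℂ → ℂ) (u v : List ℂ) : A :=
  ∑ S : Finset (Fin u.length), ∑ Q : Finset (Fin v.length),
    if S.card = Q.card then
      (KizL c (sel v Q) (sel u S) * prodFF c (sel u S) (sel u Sᶜ) *
          prodGG c (sel v Qᶜ) (sel v Q) * lamP lam2 (sel u S)) •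
        (TT c (T 0 2) (sel v Q) * TT c (T 1 2) (sel v Qᶜ) * Tprod (T 0 1) (sel u Sᶜ))
    else 0

/-- First explicit expression for the `Y(1|2)` Bethe vector, without the overall
sign `(-1)^b` (operator part). -/
def PhiTA (c : ℂ) (T : Fin 3 → Fin 3 → ℂ → A) (lam2 : ℂ → ℂ) (u v : List ℂ) : A :=
  ∑ S : Finset (Fin u.length), ∑ Q : Finset (Fin v.length),
    if S.card = Q.card then
      (prodGG c (sel u S) (sel v Q) * prodFF c (sel v Q) (sel v Qᶜ) *
          prodGG c (sel u Sᶜ) (sel u S) * prodHHne c (sel v Q) * lamP lam2 (sel u S)) •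
        (TT c (T 0 2) (sel v Q) * Tprod (T 1 2) (sel v Qᶜ) * TT c (T 0 1) (sel u Sᶜ))
    else 0

/-- Second explicit expression for the `Y(1|2)` Bethe vector, without the overall
sign `(-1)^b` (operator part). -/
def PhiTB (c : ℂ) (T : Fin 3 → Fin 3 → ℂ → A) (lam2 : ℂ → ℂ) (u v : List ℂ) : A :=
  ∑ S : Finset (Fin u.length), ∑ Q : Finset (Fin v.length),
    if S.card = Q.card then
      (KizL c (sel u S) (sel v Q) * prodFF c (sel v Q) (sel v Qᶜ) *
          prodGG c (sel u Sᶜ) (sel u S) * lamP lam2 (sel v Q)) •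
        (TT c (T 0 2) (sel u S) * TT c (T 0 1) (sel u Sᶜ) * Tprod (T 1 2) (sel v Qᶜ))
    else 0

/-- First explicit expression for the dual `Y(2|1)` Bethe vector, without the
overall sign `(-1)^{b(b-1)/2}`.  `E` is a right `A`-module, i.e. a left
`Aᵐᵒᵖ`-module; `op X • Ωd` is `Ωd · X`. -/
def PsiA {E : Type*} [AddCommGroup E] [Module ℂ E] [Module Aᵐᵒᵖ E]
    (c : ℂ) (T : Fin 3 → Fin 3 → ℂ → A) (lam2 : ℂ → ℂ) (u v : List ℂ) (Ωd : E) : E :=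
  ∑ S : Finset (Fin u.length), ∑ Q : Finset (Fin v.length),
    if S.card = Q.card then
      (prodGG c (sel v Q) (sel u S) * prodFF c (sel u S) (sel u Sᶜ) *
          prodGG c (sel v Qᶜ) (sel v Q) * prodHHne c (sel u S) * lamP lam2 (sel v Q)) •
        (op (TTrev c (T 2 1) (sel v Qᶜ) * Tprod (T 1 0) (sel u Sᶜ) *
              TTrev c (T 2 0) (sel u S)) • Ωd)
    else 0

/-- The dual `Y(2|1)` Bethe vector `Ψ_{a,b}(ū,v̄)`. -/
def Psi {E : Type*} [AddCommGroup E] [Module ℂ E] [Module Aᵐᵒᵖ E]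
    (c : ℂ) (T : Fin 3 → Fin 3 → ℂ → A) (lam2 : ℂ → ℂ) (u v : List ℂ) (Ωd : E) : E :=
  ((-1 : ℂ) ^ (v.length * (v.length - 1) / 2)) • PsiA c T lam2 u v Ωd

/-- Second explicit expression for the dual `Y(2|1)` Bethe vector, without the
overall sign `(-1)^{b(b-1)/2}`. -/
def PsiB {E : Type*} [AddCommGroup E] [Module ℂ E] [Module Aᵐᵒᵖ E]
    (c : ℂ) (T : Fin 3 → Fin 3 → ℂ → A) (lam2 : ℂ → ℂ) (u v : List ℂ) (Ωd : E) : E :=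
  ∑ S : Finset (Fin u.length), ∑ Q : Finset (Fin v.length),
    if S.card = Q.card then
      (KizL c (sel v Q) (sel u S) * prodFF c (sel u S) (sel u Sᶜ) *
          prodGG c (sel v Qᶜ) (sel v Q) * lamP lam2 (sel u S)) •
        (op (Tprod (T 1 0) (sel u Sᶜ) * TTrev c (T 2 1) (sel v Qᶜ) *
              TTrev c (T 2 0) (sel v Q)) • Ωd)
    else 0

set_option linter.unusedSectionVars false

set_option linter.unusedSectionVars false

section scalars

variable {ι : Type*} [DecidableEq ι]

/-- indexed version of `g` -/
def G (c : ℂ) (x : ι → ℂ) (i j : ι) : ℂ := gg c (x i) (x j)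

/-- indexed version of `f` -/
def F (c : ℂ) (x : ι → ℂ) (i j : ι) : ℂ := ff c (x i) (x j)

/-- indexed version of `h` -/
def H (c : ℂ) (x : ι → ℂ) (i j : ι) : ℂ := hh c (x i) (x j)

/-- good parameters -/
structure Good (c : ℂ) (x : ι → ℂ) : Prop where
  hc : c ≠ 0
  ne : ∀ i j, i ≠ j → x i ≠ x j
  nc : ∀ i j, i ≠ j → x i - x j + c ≠ 0

lemma prodG_left (c : ℂ) (x : ι → ℂ) (U : Finset ι) (w : ι) :
    ∏ i ∈ U, G c x i w = (-c) ^ U.card * (∏ i ∈ U, (x w - x i))⁻¹ := by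
  rw [← Finset.prod_const, ← Finset.prod_inv_distrib, ← Finset.prod_mul_distrib]
  refine Finset.prod_congr rfl fun i _ => ?_
  rw [G, gg, ← neg_sub (x w) (x i), div_neg, div_eq_mul_inv, neg_mul]

lemma prodF_right (c : ℂ) (x : ι → ℂ) (V : Finset ι) (w : ι) :
    ∏ i ∈ V, F c x w i = (∏ i ∈ V, (x w - x i + c)) * (∏ i ∈ V, (x w - x i))⁻¹ := by
  rw [← Finset.prod_inv_distrib, ← Finset.prod_mul_distrib]
  refine Finset.prod_congr rfl fun i _ => ?_
  rw [F, ff, div_eq_mul_inv]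

lemma prodH_right (c : ℂ) (x : ι → ℂ) (V : Finset ι) (w : ι) :
    ∏ i ∈ V, H c x w i = (∏ i ∈ V, (x w - x i + c)) * (c⁻¹) ^ V.card := by
  rw [← Finset.prod_const, ← Finset.prod_mul_distrib]
  refine Finset.prod_congr rfl fun i _ => ?_
  rw [H, hh, div_eq_mul_inv]

/-- partial fraction expansion -/
lemma pf {c : ℂ} {x : ι → ℂ} (hg : Good c x) (U V' V : Finset ι) (w : ι)
    (hd : Disjoint U V') (hU : w ∉ U) (hV' : w ∉ V') (hcard : U.card = V.card + 1) :
    (∏ i ∈ U, G c x i w) * (∏ j ∈ V', F c x w j) * (∏ j ∈ V, H c x w j)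
      = (∑ y ∈ V', G c x w y * ((∏ i ∈ U, G c x i y) * (∏ j ∈ V'.erase y, F c x y j) *
          (∏ j ∈ V, H c x y j)))
        + ∑ i ∈ U, G c x i w * ((∏ k ∈ U.erase i, G c x k i) * (∏ j ∈ V', F c x i j) *
          (∏ j ∈ V, H c x i j)) := by
  classical
  have hc := hg.hc
  set N : Polynomial ℂ := (∏ j ∈ V', (Polynomial.X - Polynomial.C (x j - c))) *
    ∏ j ∈ V, (Polynomial.X - Polynomial.C (x j - c)) with hN
  have hev : ∀ z, N.eval z = (∏ j ∈ V', (z - x j + c)) * ∏ j ∈ V, (z - x j + c) := by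
    intro z
    simp only [hN, Polynomial.eval_mul, Polynomial.eval_prod, Polynomial.eval_sub,
      Polynomial.eval_X, Polynomial.eval_C]
    congr 1 <;> exact Finset.prod_congr rfl fun j _ => by ring
  have hdeg : N.degree < ((U ∪ V').card : ℕ) := by
    rw [hN, Polynomial.degree_mul, Polynomial.degree_prod, Polynomial.degree_prod]
    simp only [Polynomial.degree_X_sub_C, Finset.sum_const, nsmul_eq_mul, mul_one]
    rw [Finset.card_union_of_disjoint hd, hcard]
    norm_cast
    omega
  have hinj : Set.InjOn x (U ∪ V' : Finset ι) := by
    intro i _ j _ hij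
    by_contra h
    exact hg.ne i j h hij
  have hwS : ∀ i ∈ U ∪ V', x w ≠ x i := by
    intro i hi
    refine hg.ne _ _ ?_
    rintro rfl
    simp_all
  have key := congrArg (Polynomial.eval (x w)) (Lagrange.eq_interpolate hinj hdeg)
  rw [Lagrange.eval_interpolate_not_at_node _ hwS, Lagrange.eval_nodal] at key
  have hnz : ∏ i ∈ U ∪ V', (x w - x i) ≠ 0 :=
    Finset.prod_ne_zero_iff.2 fun i hi => sub_ne_zero.2 (hwS i hi)
  have key2 : N.eval (x w) * (∏ i ∈ U ∪ V', (x w - x i))⁻¹ =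
      ∑ i ∈ U ∪ V', Lagrange.nodalWeight (U ∪ V') x i * (x w - x i)⁻¹ * N.eval (x i) := by
    rw [key]; field_simp
  have hw : ∀ i, Lagrange.nodalWeight (U ∪ V') x i
      = (∏ j ∈ (U ∪ V').erase i, (x i - x j))⁻¹ := by
    intro i
    rw [Lagrange.nodalWeight_eq_eval_nodal_erase_inv, Lagrange.eval_nodal]
  rw [Finset.sum_union hd, Finset.prod_union hd, hev] at key2
  have : (∏ i ∈ U, G c x i w) * (∏ j ∈ V', F c x w j) * (∏ j ∈ V, H c x w j)
      = ((-c) ^ U.card * (c⁻¹) ^ V.card) * (((∏ j ∈ V', (x w - x j + c)) *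
        ∏ j ∈ V, (x w - x j + c)) * ((∏ i ∈ U, (x w - x i)) * ∏ i ∈ V', (x w - x i))⁻¹) := by
    rw [prodG_left, prodF_right, prodH_right, mul_inv]; ring
  rw [this, key2, mul_add, add_comm, Finset.mul_sum, Finset.mul_sum]
  congr 1
  · refine Finset.sum_congr rfl fun y hy => ?_
    have hyU : y ∉ U := fun h => Finset.disjoint_left.1 hd h hy
    have e1 : (U ∪ V').erase y = U ∪ V'.erase y := by
      rw [Finset.erase_union_distrib, Finset.erase_eq_of_notMem hyU]
    rw [hw, e1, Finset.prod_union (Finset.disjoint_of_subset_right (Finset.erase_subset _ _) hd),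
      hev, prodG_left, prodF_right, prodH_right, ← Finset.mul_prod_erase V' _ hy, mul_inv, G, gg]
    ring
  · refine Finset.sum_congr rfl fun i hi => ?_
    have hiV : i ∉ V' := fun h => Finset.disjoint_left.1 hd hi h
    have e1 : (U ∪ V').erase i = U.erase i ∪ V' := by
      rw [Finset.erase_union_distrib, Finset.erase_eq_of_notMem hiV]
    have e2 : U.card = (U.erase i).card + 1 := (Finset.card_erase_add_one hi).symm
    rw [hw, e1, Finset.prod_union (Finset.disjoint_of_subset_left (Finset.erase_subset _ _) hd),
      hev, prodG_left, prodF_right, prodH_right, e2, mul_inv, G, gg, ← neg_sub (x w) (x i), div_neg]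
    ring

lemma Good.neg {c : ℂ} {x : ι → ℂ} (hg : Good c x) : Good c (fun i => - x i) where
  hc := hg.hc
  ne i j h e := hg.ne i j h (neg_injective e)
  nc i j h := by
    have := hg.nc j i (Ne.symm h)
    intro e; apply this; rw [← e]; ring

lemma G_neg (c : ℂ) (x : ι → ℂ) (i j : ι) : G c (fun i => - x i) i j = G c x j i := by
  simp only [G, gg]; congr 1; ring
lemma F_neg (c : ℂ) (x : ι → ℂ) (i j : ι) : F c (fun i => - x i) i j = F c x j i := by
  simp only [F, ff]; congr 1 <;> ring
lemma H_neg (c : ℂ) (x : ι → ℂ) (i j : ι) : H c (fun i => - x i) i j = H c x j i := by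
  simp only [H, hh]; congr 1; ring

lemma G_anti (c : ℂ) (x : ι → ℂ) (i j : ι) : G c x j i = - G c x i j := by
  rw [G, G, gg, gg, ← neg_sub (x i) (x j), div_neg]

/-- simple partial fractions -/
lemma pf1 {c : ℂ} {x : ι → ℂ} (hg : Good c x) (V : Finset ι) (y w : ι)
    (hy : y ∉ V) (hw : w ∉ V) (hyw : y ≠ w) :
    G c x y w * (∏ j ∈ V, F c x w j)
      = (∑ k ∈ V, G c x w k * (G c x y k * ∏ j ∈ V.erase k, F c x k j))
        + G c x y w * ∏ j ∈ V, F c x y j := by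
  have := pf hg {y} V ∅ w (by simpa using hy) (by simpa using hyw.symm) hw (by simp)
  simpa using this

/-- simple partial fractions -/
lemma pf2 {c : ℂ} {x : ι → ℂ} (hg : Good c x) (V : Finset ι) (z w : ι)
    (hy : z ∉ V) (hw : w ∉ V) (hyw : z ≠ w) :
    G c x z w * (∏ j ∈ V, F c x j w)
      = (∑ k ∈ V, G c x k w * (G c x z k * ∏ j ∈ V.erase k, F c x j k))
        + G c x z w * ∏ j ∈ V, F c x j z := by
  have := pf1 hg.neg V z w hy hw hyw
  simp only [G_neg, F_neg] at this
  have e : ∀ k, G c x k w * (G c x z k * ∏ j ∈ V.erase k, F c x j k)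
      = - (G c x k w * (G c x k z * ∏ j ∈ V.erase k, F c x j k)) := by
    intro k; rw [G_anti c x k z]; ring
  simp only [e, Finset.sum_neg_distrib]
  rw [G_anti c x w z, neg_mul, this]
  ring

lemma G_ne {c : ℂ} {x : ι → ℂ} (hg : Good c x) {i j : ι} (h : i ≠ j) : G c x i j ≠ 0 :=
  div_ne_zero hg.hc (sub_ne_zero.2 (hg.ne i j h))
lemma F_ne {c : ℂ} {x : ι → ℂ} (hg : Good c x) {i j : ι} (h : i ≠ j) : F c x i j ≠ 0 :=
  div_ne_zero (hg.nc i j h) (sub_ne_zero.2 (hg.ne i j h))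
lemma H_ne {c : ℂ} {x : ι → ℂ} (hg : Good c x) {i j : ι} (h : i ≠ j) : H c x i j ≠ 0 :=
  div_ne_zero (hg.nc i j h) hg.hc
lemma GH {c : ℂ} {x : ι → ℂ} (hg : Good c x) (i j : ι) : G c x i j * H c x i j = F c x i j := by
  have := hg.hc
  simp only [G, H, F, gg, hh, ff]
  rw [div_mul_div_comm, mul_comm c, mul_div_mul_right _ _ this]
lemma F_eq {c : ℂ} {x : ι → ℂ} (hg : Good c x) {i j : ι} (h : i ≠ j) :
    F c x i j = 1 + G c x i j := by
  have := sub_ne_zero.2 (hg.ne i j h)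
  simp only [G, F, gg, ff]
  field_simp
/-- three-term identity -/
lemma G3 {c : ℂ} {x : ι → ℂ} (hg : Good c x) {i j k : ι} (h : i ≠ j) (h' : j ≠ k) (h'' : i ≠ k) :
    G c x i j * G c x j k = G c x i k * (G c x j k + G c x i j) := by
  have h1 := sub_ne_zero.2 (hg.ne i j h)
  have h2 := sub_ne_zero.2 (hg.ne j k h')
  have h3 := sub_ne_zero.2 (hg.ne i k h'')
  simp only [G, gg]
  field_simp
  ring

end scalars

section ops

variable {ι : Type*} [DecidableEq ι]

/-- normalized ordered product over a list of indices -/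
def PL (κ : ι → ι → ℂ) (T : ι → A) : List ι → A
  | [] => 1
  | i :: l => ((l.map fun y => κ y i).prod)⁻¹ • (T i * PL κ T l)

/-- exchange property -/
def Exch (κ : ι → ι → ℂ) (T : ι → A) : Prop :=
  ∀ i j, i ≠ j → (κ j i)⁻¹ • (T i * T j) = (κ i j)⁻¹ • (T j * T i)

lemma PL_perm {κ : ι → ι → ℂ} {T : ι → A} (hE : Exch κ T) {l l' : List ι} (h : l.Perm l') :
    l.Nodup → PL κ T l = PL κ T l' := by
  induction h with
  | nil => intro _; rfl
  | cons i h ih =>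
    intro hn
    rw [PL, PL, ih (List.nodup_cons.1 hn).2, (h.map _).prod_eq]
  | swap i j l =>
    intro hn
    have hij : j ≠ i := by
      intro e; subst e; simp at hn
    simp only [PL, List.map_cons, List.prod_cons, mul_inv, mul_smul_comm, smul_smul]
    have := hE j i hij
    calc _ = (((l.map fun y => κ y j).prod)⁻¹ * ((l.map fun y => κ y i).prod)⁻¹) •
          (((κ i j)⁻¹ • (T j * T i)) * PL κ T l) := by
            rw [smul_mul_assoc, smul_smul, mul_assoc (T j)]; congr 1; ring
      _ = _ := by
            rw [this, smul_mul_assoc, smul_smul, mul_assoc (T i)]; congr 1; ring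
  | trans h1 h2 ih1 ih2 =>
    intro hn
    rw [ih1 hn, ih2 (h1.nodup_iff.1 hn)]

/-- normalized ordered product over a finset -/
def P (κ : ι → ι → ℂ) (T : ι → A) (s : Finset ι) : A := PL κ T s.toList

lemma P_empty (κ : ι → ι → ℂ) (T : ι → A) : P κ T ∅ = 1 := by
  simp [P, PL]

lemma P_insert {κ : ι → ι → ℂ} {T : ι → A} (hE : Exch κ T) {i : ι} {s : Finset ι} (h : i ∉ s) :
    P κ T (insert i s) = (∏ y ∈ s, κ y i)⁻¹ • (T i * P κ T s) := by
  rw [P, PL_perm hE (Finset.toList_insert h) (Finset.nodup_toList _), PL, P,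
    Finset.prod_map_toList]

lemma P_mul {κ : ι → ι → ℂ} {T : ι → A} (hE : Exch κ T) {i : ι} {s : Finset ι} (h : i ∉ s)
    (h0 : ∀ j, j ≠ i → κ j i ≠ 0) :
    T i * P κ T s = (∏ y ∈ s, κ y i) • P κ T (insert i s) := by
  rw [P_insert hE h, smul_smul, mul_inv_cancel₀, one_smul]
  refine Finset.prod_ne_zero_iff.2 fun j hj => h0 j ?_
  rintro rfl; exact h hj

/-- the relations we use -/
structure Rel (c : ℂ) (x : ι → ℂ) (a b d e : ι → A) : Prop where
  good : Good c x
  aa : Exch (H c x) a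
  bb : Exch (H c x) b
  dd : ∀ i j, d i * d j = d j * d i
  ee : ∀ i j, e i * e j = e j * e i
  db : ∀ w y, w ≠ y → d w * b y = F c x y w • (b y * d w) + G c x w y • (b w * d y)
  ed : ∀ y w, y ≠ w → e y * d w = F c x y w • (d w * e y) + G c x w y • (d y * e w)
  ad : ∀ w z, w ≠ z → d w * a z = a z * d w + G c x z w • (b z * e w) - G c x z w • (b w * e z)
  ea : ∀ w z, w ≠ z → e w * a z = F c x z w • (a z * e w) + G c x w z • (a w * e z)
  ab : ∀ z y, z ≠ y → a z * b y = G c x y z • (b z * a y) - F c x y z • (b y * a z)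

variable {c : ℂ} {x : ι → ℂ} {a b d e : ι → A}

/-- unnormalized product -/
def P1 (T : ι → A) (s : Finset ι) : A := P (fun _ _ => 1) T s

lemma P1_exch {T : ι → A} (h : ∀ i j, T i * T j = T j * T i) : Exch (fun _ _ => 1) T := by
  intro i j _; rw [h]

lemma P1_insert {T : ι → A} (hT : ∀ i j, T i * T j = T j * T i) {i : ι} {s : Finset ι}
    (h : i ∉ s) : P1 T (insert i s) = T i * P1 T s := by
  rw [P1, P_insert (P1_exch hT) h]; simp [P1]

lemma P1_comm {T : ι → A} (hT : ∀ i j, T i * T j = T j * T i) (i : ι) (s : Finset ι) :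
    T i * P1 T s = P1 T s * T i := by
  induction s using Finset.induction_on with
  | empty => simp [P1, P_empty]
  | insert j s hj ih => rw [P1_insert hT hj, ← mul_assoc, hT i j, mul_assoc, ih, mul_assoc]

lemma P1_erase {T : ι → A} (hT : ∀ i j, T i * T j = T j * T i) {i : ι} {s : Finset ι}
    (h : i ∈ s) : P1 T s = T i * P1 T (s.erase i) := by
  rw [← P1_insert hT (Finset.notMem_erase i s), Finset.insert_erase h]

lemma P_erase (hg : Good c x) {T : ι → A} (hT : Exch (H c x) T) {i : ι} {s : Finset ι}
    (h : i ∈ s) : T i * P (H c x) T (s.erase i) = (∏ y ∈ s.erase i, H c x y i) • P (H c x) T s := by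
  rw [P_mul hT (Finset.notMem_erase i s) (fun j hj => H_ne hg hj), Finset.insert_erase h]

lemma GHp (hg : Good c x) (s : Finset ι) (i : ι) :
    (∏ y ∈ s, G c x y i) * ∏ y ∈ s, H c x y i = ∏ y ∈ s, F c x y i := by
  rw [← Finset.prod_mul_distrib]; exact Finset.prod_congr rfl fun y _ => GH hg y i

lemma Hp_ne (hg : Good c x) {s : Finset ι} {i : ι} (h : i ∉ s) : ∏ y ∈ s, H c x y i ≠ 0 :=
  Finset.prod_ne_zero_iff.2 fun y hy => H_ne hg (by rintro rfl; exact h hy)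

lemma ne_of_mem_notMem {s : Finset ι} {i j : ι} (hi : i ∈ s) (hj : j ∉ s) : i ≠ j := by
  rintro rfl; exact hj hi

/-- moving one operator through a product of others; `X` through `Y`s. -/
lemma move (hg : Good c x) {X Y : ι → A} (hY : Exch (H c x) Y)
    (hX : ∀ w z, w ≠ z → X w * Y z = F c x z w • (Y z * X w) + G c x w z • (Y w * X z))
    (U : Finset ι) (w : ι) (hw : w ∉ U) :
    X w * P (H c x) Y U = (∏ i ∈ U, F c x i w) • (P (H c x) Y U * X w)
      + ∑ i ∈ U, (G c x w i * ∏ k ∈ U.erase i, G c x k i) •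
          (Y w * P (H c x) Y (U.erase i) * X i) := by
  induction U using Finset.induction_on generalizing w with
  | empty => simp [P_empty]
  | insert z U hz ih =>
    have hwz : w ≠ z := by rintro rfl; simp at hw
    have hwU : w ∉ U := fun h => hw (Finset.mem_insert_of_mem h)
    have hH := Hp_ne hg hz
    refine smul_right_injective A hH ?_
    dsimp only
    have e1 : (∏ y ∈ U, H c x y z) • (X w * P (H c x) Y (insert z U))
        = X w * Y z * P (H c x) Y U := by
      rw [mul_assoc, P_mul hY hz (fun j hj => H_ne hg hj), mul_smul_comm]
    rw [e1, hX w z hwz, add_mul, smul_mul_assoc, smul_mul_assoc, mul_assoc, mul_assoc,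
      ih w hwU, ih z hz, Finset.sum_insert hz, Finset.prod_insert hz, Finset.erase_insert hz]
    simp only [mul_add, smul_add, mul_smul_comm, smul_smul, Finset.mul_sum, Finset.smul_sum]
    have e2 : Y z * (P (H c x) Y U * X w) = (∏ y ∈ U, H c x y z) •
        (P (H c x) Y (insert z U) * X w) := by
      rw [← mul_assoc, P_mul hY hz (fun j hj => H_ne hg hj), smul_mul_assoc]
    rw [e2, smul_smul, add_assoc]
    congr 1
    · congr 1; ring
    rw [add_left_comm]
    congr 1
    · rw [mul_assoc (Y w)]; congr 1
      rw [← GHp hg]; ring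
    rw [← Finset.sum_add_distrib]
    refine Finset.sum_congr rfl fun i hi => ?_
    have hiz : i ≠ z := ne_of_mem_notMem hi hz
    have hiw : i ≠ w := ne_of_mem_notMem hi hwU
    have hzi : z ∉ U.erase i := fun h => hz (Finset.mem_of_mem_erase h)
    have e3 : (insert z U).erase i = insert z (U.erase i) := Finset.erase_insert_of_ne hiz.symm
    rw [e3, Finset.prod_insert hzi]
    have e4 : Y w * (Y z * P (H c x) Y (U.erase i) * X i) = (∏ y ∈ U.erase i, H c x y z) •
        (Y w * P (H c x) Y (insert z (U.erase i)) * X i) := by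
      rw [P_mul hY hzi (fun j hj => H_ne hg hj), smul_mul_assoc, mul_smul_comm, mul_assoc]
    have e5 : Y z * (Y w * P (H c x) Y (U.erase i) * X i) =
        (H c x w z * (H c x z w)⁻¹) • (Y w * (Y z * P (H c x) Y (U.erase i) * X i)) := by
      have := hY z w hwz.symm
      have h2 : Y z * Y w = (H c x w z * (H c x z w)⁻¹) • (Y w * Y z) := by
        rw [mul_smul, ← this, smul_smul, mul_inv_cancel₀ (H_ne hg hwz), one_smul]
      simp only [mul_assoc]
      rw [← mul_assoc (Y z) (Y w), h2, smul_mul_assoc]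
      simp only [mul_assoc]
    rw [e5, e4, smul_smul, smul_smul, smul_smul, ← add_smul]
    congr 1
    rw [← Finset.mul_prod_erase U _ hi]
    have h1 : F c x z w * (H c x w z * (H c x z w)⁻¹) = - F c x w z := by
      rw [← GH hg z w, ← GH hg w z, G_anti c x w z]
      have := H_ne hg hwz.symm
      field_simp
    have h2 : G c x z i * H c x i z = - F c x i z := by
      rw [← GH hg i z, G_anti c x i z]; ring
    have h3 : F c x w z * G c x w i - G c x w z * G c x z i = F c x i z * G c x w i := by
      rw [F_eq hg hwz, F_eq hg hiz, G3 hg hwz hiz.symm hiw.symm, G_anti c x z i]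
      ring
    linear_combination ((∏ x_1 ∈ U.erase i, H c x x_1 z) *
      ∏ k ∈ U.erase i, G c x k i) * (G c x w i * h1 - G c x w i * h2 - h3)

lemma moveE (h : Rel c x a b d e) (J : Finset ι) (w : ι) (hw : w ∉ J) :
    P1 e J * d w = (∏ j ∈ J, F c x j w) • (d w * P1 e J)
      + ∑ y ∈ J, (G c x w y * ∏ k ∈ J.erase y, F c x k y) • (d y * P1 e (J.erase y) * e w) := by
  have hg := h.good
  induction J using Finset.induction_on generalizing w with
  | empty => simp [P1, P_empty]
  | insert z J hz ih =>
    have hwz : w ≠ z := by rintro rfl; simp at hw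
    have hwU : w ∉ J := fun h => hw (Finset.mem_insert_of_mem h)
    rw [P1_insert h.ee hz, mul_assoc, ih w hwU, Finset.sum_insert hz, Finset.prod_insert hz,
      Finset.erase_insert hz]
    have e1 : ∀ y ∈ J, (G c x w y * ∏ k ∈ (insert z J).erase y, F c x k y) •
        (d y * P1 e ((insert z J).erase y) * e w) =
        (G c x w y * (F c x z y * ∏ k ∈ J.erase y, F c x k y)) •
          (d y * (e z * P1 e (J.erase y)) * e w) := by
      intro y hy
      have hyz : y ≠ z := ne_of_mem_notMem hy hz
      have hzi : z ∉ J.erase y := fun h => hz (Finset.mem_of_mem_erase h)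
      rw [Finset.erase_insert_of_ne hyz.symm, Finset.prod_insert hzi, P1_insert h.ee hzi]
    have e2 : ∀ y ∈ J, e z * ((G c x w y * ∏ k ∈ J.erase y, F c x k y) •
        (d y * P1 e (J.erase y) * e w)) =
        (G c x w y * (F c x z y * ∏ k ∈ J.erase y, F c x k y)) •
          (d y * (e z * P1 e (J.erase y)) * e w) +
        (G c x w y * (G c x y z * ∏ k ∈ J.erase y, F c x k y)) • (d z * P1 e J * e w) := by
      intro y hy
      have hyz : y ≠ z := ne_of_mem_notMem hy hz
      rw [mul_smul_comm, ← mul_assoc, ← mul_assoc, h.ed z y hyz.symm, P1_erase h.ee hy]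
      simp only [add_mul, smul_mul_assoc, smul_add, smul_smul, mul_assoc]
      congr 2 <;> ring
    rw [mul_add, Finset.mul_sum, Finset.sum_congr rfl e1, Finset.sum_congr rfl e2,
      Finset.sum_add_distrib, mul_smul_comm, ← mul_assoc, h.ed z w hwz.symm]
    simp only [add_mul, smul_mul_assoc, smul_add, smul_smul, mul_assoc]
    rw [P1_comm h.ee w J, ← Finset.sum_smul]
    have hp := pf2 hg J z w hz hwU hwz.symm
    have hp2 : G c x w z * ∏ k ∈ J, F c x k z = (∏ j ∈ J, F c x j w) * G c x w z +
        ∑ y ∈ J, G c x w y * (G c x y z * ∏ k ∈ J.erase y, F c x k y) := by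
      have : ∀ y, G c x w y * (G c x y z * ∏ k ∈ J.erase y, F c x k y) =
          G c x y w * (G c x z y * ∏ k ∈ J.erase y, F c x k y) := by
        intro y; rw [G_anti c x w y, G_anti c x z y]; ring
      simp only [this]
      rw [G_anti c x z w]
      linear_combination hp
    rw [hp2, add_smul, mul_comm (F c x z w)]
    abel

/-- commutation of one `d` with the product of `a`s -/
lemma baseC (h : Rel c x a b d e) (U : Finset ι) (w : ι) (hw : w ∉ U) :
    d w * P (H c x) a U = P (H c x) a U * d w +
      ∑ i ∈ U, (G c x i w * ∏ k ∈ U.erase i, G c x k i) •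
        (b i * P (H c x) a (U.erase i) * e w - b w * P (H c x) a (U.erase i) * e i) := by
  have hg := h.good
  induction U using Finset.induction_on with
  | empty => simp [P_empty]
  | insert z U hz ih =>
    have hwz : w ≠ z := by rintro rfl; simp at hw
    have hwU : w ∉ U := fun h => hw (Finset.mem_insert_of_mem h)
    have hH := Hp_ne hg hz
    refine smul_right_injective A hH ?_
    dsimp only
    have eP : a z * P (H c x) a U = (∏ y ∈ U, H c x y z) • P (H c x) a (insert z U) :=
      P_mul h.aa hz (fun j hj => H_ne hg hj)
    have e1 : (∏ y ∈ U, H c x y z) • (d w * P (H c x) a (insert z U))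
        = d w * a z * P (H c x) a U := by
      rw [mul_assoc, eP, mul_smul_comm]
    have m1 := move hg h.aa h.ea U w hwU
    have m2 := move hg h.aa h.ea U z hz
    have e2 : a z * d w * P (H c x) a U = a z * P (H c x) a U * d w +
      ∑ i ∈ U, (G c x i w * ∏ k ∈ U.erase i, G c x k i) •
        (a z * b i * P (H c x) a (U.erase i) * e w
          - a z * b w * P (H c x) a (U.erase i) * e i) := by
      rw [mul_assoc, ih hwU, mul_add, Finset.mul_sum]
      simp only [mul_assoc, mul_smul_comm, mul_sub]
    have e3 : ∀ i ∈ U, (G c x i w * ∏ k ∈ U.erase i, G c x k i) •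
        (a z * b i * P (H c x) a (U.erase i) * e w
          - a z * b w * P (H c x) a (U.erase i) * e i) =
        (G c x i w * (G c x i z * ∏ k ∈ U.erase i, F c x k i)) • (b z * P (H c x) a U * e w)
        + (∏ y ∈ U, H c x y z) • ((G c x i w * ∏ k ∈ (insert z U).erase i, G c x k i) •
            (b i * P (H c x) a ((insert z U).erase i) * e w
              - b w * P (H c x) a ((insert z U).erase i) * e i))
        + (G c x z w * (G c x z i * ∏ k ∈ U.erase i, G c x k i)) •
            (b w * (a z * P (H c x) a (U.erase i) * e i))
        - (G c x z w * (G c x w i * ∏ k ∈ U.erase i, G c x k i)) •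
            (b z * (a w * P (H c x) a (U.erase i) * e i)) := by
      intro i hi
      have hiz : i ≠ z := ne_of_mem_notMem hi hz
      have hiw : i ≠ w := ne_of_mem_notMem hi hwU
      have hzi : z ∉ U.erase i := fun h => hz (Finset.mem_of_mem_erase h)
      rw [Finset.erase_insert_of_ne hiz.symm, Finset.prod_insert hzi]
      have q1 : b i * P (H c x) a (insert z (U.erase i)) * e w =
          (∏ y ∈ U.erase i, H c x y z)⁻¹ • (b i * a z * P (H c x) a (U.erase i) * e w) := by
        rw [P_insert h.aa hzi, mul_smul_comm, smul_mul_assoc]; simp only [mul_assoc]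
      have q2 : b w * P (H c x) a (insert z (U.erase i)) * e i =
          (∏ y ∈ U.erase i, H c x y z)⁻¹ • (b w * a z * P (H c x) a (U.erase i) * e i) := by
        rw [P_insert h.aa hzi, mul_smul_comm, smul_mul_assoc]; simp only [mul_assoc]
      have q3 : b z * a i * P (H c x) a (U.erase i) * e w =
          (∏ y ∈ U.erase i, H c x y i) • (b z * P (H c x) a U * e w) := by
        rw [mul_assoc (b z), P_erase hg h.aa hi, mul_smul_comm, smul_mul_assoc]
      rw [q1, q2, h.ab z i hiz.symm, h.ab z w hwz.symm, ← mul_assoc (b w), ← mul_assoc (b w),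
        ← mul_assoc (b z) (a w * _), ← mul_assoc (b z) (a w)]
      simp only [sub_mul, smul_mul_assoc]
      rw [q3]
      have hH' := Hp_ne hg hzi
      have hh := Finset.mul_prod_erase U (fun y => H c x y z) hi
      have hGH := GHp hg (U.erase i) i
      have h2 : G c x z i * H c x i z = - F c x i z := by
        rw [← GH hg i z, G_anti c x i z]; ring
      have h3 : G c x i w * F c x w z = G c x i w * F c x i z + G c x z w * G c x z i := by
        have := G3 hg hiw hwz hiz
        rw [F_eq hg hwz, F_eq hg hiz, G_anti c x i z, G_anti c x w z]
        linear_combination this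
      have hH'' : (∏ y ∈ U, H c x y z) * (∏ y ∈ U.erase i, H c x y z)⁻¹ = H c x i z := by
        rw [← hh]; field_simp
      have hwz' : G c x w z = - G c x z w := G_anti c x z w
      have hiw' : G c x w i = - G c x i w := G_anti c x i w
      simp only [smul_add, smul_sub, smul_smul]
      match_scalars
      · linear_combination (G c x i w * G c x i z) * hGH
      · linear_combination (- G c x i w * (∏ k ∈ U.erase i, G c x k i)) * h2 -
          (G c x i w * G c x z i * ∏ k ∈ U.erase i, G c x k i) * hH''
      · rw [hwz', hiw']; ring
      · linear_combination (∏ k ∈ U.erase i, G c x k i) * h3 +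
          (G c x i w * (∏ k ∈ U.erase i, G c x k i)) * h2 +
          (G c x i w * G c x z i * ∏ k ∈ U.erase i, G c x k i) * hH''
    have hp := pf2 hg U z w hz hwU hwz.symm
    have hp2 : (∑ i ∈ U, G c x i w * (G c x i z * ∏ k ∈ U.erase i, F c x k i)) +
        G c x z w * (∏ i ∈ U, F c x i w) = G c x z w * ∏ i ∈ U, F c x i z := by
      have : ∀ i, G c x i w * (G c x i z * ∏ k ∈ U.erase i, F c x k i) =
          - (G c x i w * (G c x z i * ∏ k ∈ U.erase i, F c x k i)) := by
        intro i; rw [G_anti c x z i]; ring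
      simp only [this, Finset.sum_neg_distrib]
      linear_combination hp
    have hGHU := GHp hg U z
    rw [e1, h.ad w z hwz, sub_mul, add_mul, e2, Finset.sum_congr rfl e3, Finset.sum_sub_distrib,
      Finset.sum_add_distrib, Finset.sum_add_distrib, Finset.sum_insert hz, Finset.erase_insert hz,
      smul_mul_assoc, smul_mul_assoc, mul_assoc (b z) (e w), mul_assoc (b w) (e z), m1, m2, eP,
      ← Finset.sum_smul, ← Finset.smul_sum, eq_sub_of_add_eq hp2, ← hGHU]
    simp only [mul_add, Finset.mul_sum, mul_smul_comm, smul_mul_assoc, smul_add, smul_sub,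
      Finset.smul_sum, smul_smul, mul_assoc]
    module

end ops

section left

variable {ι : Type*} [DecidableEq ι]
variable {c : ℂ} {x : ι → ℂ} {a b d e : ι → A}

lemma reindex1 {B : Type*} [AddCommMonoid B] (V : Finset ι) (Φ : ι → Finset ι → B) :
    ∑ J ∈ V.powerset, ∑ y ∈ J, Φ y (J.erase y) = ∑ J ∈ V.powerset, ∑ y ∈ V \ J, Φ y J := by
  rw [Finset.sum_sigma', Finset.sum_sigma']
  refine Finset.sum_bij' (fun p _ => ⟨p.1.erase p.2, p.2⟩) (fun p _ => ⟨insert p.2 p.1, p.2⟩)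
    ?_ ?_ ?_ ?_ ?_
  · rintro ⟨J, y⟩ h
    simp only [Finset.mem_sigma, Finset.mem_powerset, Finset.mem_sdiff] at h ⊢
    exact ⟨(Finset.erase_subset _ _).trans h.1, h.1 h.2, Finset.notMem_erase _ _⟩
  · rintro ⟨J, y⟩ h
    simp only [Finset.mem_sigma, Finset.mem_powerset, Finset.mem_sdiff] at h ⊢
    exact ⟨Finset.insert_subset h.2.1 h.1, Finset.mem_insert_self _ _⟩
  · rintro ⟨J, y⟩ h
    simp only [Finset.mem_sigma] at h
    simp only [Finset.insert_erase h.2]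
  · rintro ⟨J, y⟩ h
    simp only [Finset.mem_sigma, Finset.mem_sdiff] at h
    simp only [Finset.erase_insert h.2.2]
  · rintro ⟨J, y⟩ _
    rfl

lemma reindex2 {B : Type*} [AddCommMonoid B] (V : Finset ι) (Φ : ι → Finset ι → B) :
    ∑ y ∈ V, ∑ J ∈ (V.erase y).powerset, Φ y J = ∑ J ∈ V.powerset, ∑ y ∈ V \ J, Φ y J := by
  refine Finset.sum_comm' ?_
  intro y J
  simp only [Finset.mem_powerset, Finset.mem_sdiff, Finset.subset_erase]
  tauto

lemma reindex3 {B : Type*} [AddCommMonoid B] (V : Finset ι) (Φ : ι → Finset ι → B) :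
    ∑ y ∈ V, ∑ J ∈ (V.erase y).powerset, Φ y J
      = ∑ J ∈ V.powerset, ∑ y ∈ J, Φ y (J.erase y) := by
  rw [reindex1, reindex2]

/-- double products -/
def dp (Q : ι → ι → ℂ) (s t : Finset ι) : ℂ := ∏ i ∈ s, ∏ j ∈ t, Q i j

lemma dp_insert_left (Q : ι → ι → ℂ) {s : Finset ι} (t : Finset ι) {i : ι} (h : i ∉ s) :
    dp Q (insert i s) t = (∏ j ∈ t, Q i j) * dp Q s t := by
  rw [dp, Finset.prod_insert h]; rfl

lemma dp_insert_right (Q : ι → ι → ℂ) (s : Finset ι) {t : Finset ι} {j : ι} (h : j ∉ t) :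
    dp Q s (insert j t) = (∏ i ∈ s, Q i j) * dp Q s t := by
  rw [dp, dp, ← Finset.prod_mul_distrib]
  exact Finset.prod_congr rfl fun i _ => Finset.prod_insert h

lemma dp_erase_left (Q : ι → ι → ℂ) {s : Finset ι} (t : Finset ι) {i : ι} (h : i ∈ s) :
    dp Q s t = (∏ j ∈ t, Q i j) * dp Q (s.erase i) t := by
  rw [← dp_insert_left Q t (Finset.notMem_erase i s), Finset.insert_erase h]

lemma dp_erase_right (Q : ι → ι → ℂ) (s : Finset ι) {t : Finset ι} {j : ι} (h : j ∈ t) :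
    dp Q s t = (∏ i ∈ s, Q i j) * dp Q s (t.erase j) := by
  rw [← dp_insert_right Q s (Finset.notMem_erase j t), Finset.insert_erase h]

/-- product over ordered pairs of distinct elements -/
def hne (c : ℂ) (x : ι → ℂ) (J : Finset ι) : ℂ := ∏ j ∈ J, ∏ k ∈ J.erase j, H c x j k

lemma hne_insert (c : ℂ) (x : ι → ℂ) {J : Finset ι} {w : ι} (h : w ∉ J) :
    hne c x (insert w J) = (∏ j ∈ J, H c x w j) * (∏ j ∈ J, H c x j w) * hne c x J := by
  rw [hne, Finset.prod_insert h, Finset.erase_insert h, mul_assoc]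
  congr 1
  rw [hne, ← Finset.prod_mul_distrib]
  refine Finset.prod_congr rfl fun j hj => ?_
  have hjw : j ≠ w := ne_of_mem_notMem hj h
  rw [Finset.erase_insert_of_ne hjw.symm,
    Finset.prod_insert (fun hh => h (Finset.mem_of_mem_erase hh))]

/-- coefficient on the left hand side -/
def cL (c : ℂ) (x : ι → ℂ) (U V I J : Finset ι) : ℂ :=
  if I.card = J.card then
    dp (G c x) I J * dp (F c x) J (V \ J) * dp (G c x) (U \ I) I * hne c x J
  else 0

/-- operator on the left hand side -/
def tL (c : ℂ) (x : ι → ℂ) (a b d e : ι → A) (U V I J : Finset ι) : A :=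
  P (H c x) b J * P1 d (V \ J) * P (H c x) a (U \ I) * P1 e I

/-- left hand side -/
def Lf (c : ℂ) (x : ι → ℂ) (a b d e : ι → A) (U V : Finset ι) : A :=
  ∑ I ∈ U.powerset, ∑ J ∈ V.powerset, cL c x U V I J • tL c x a b d e U V I J

/-- the basic coefficient -/
def gam (c : ℂ) (x : ι → ℂ) (w : ι) (U V : Finset ι) (i : ι) : ℂ :=
  G c x i w * (∏ k ∈ U.erase i, G c x k i) * ∏ j ∈ V, F c x i j

lemma Lf_empty (U : Finset ι) : Lf c x a b d e U ∅ = P (H c x) a U := by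
  rw [Lf, Finset.sum_eq_single ∅]
  · simp [cL, tL, dp, hne, P1, P_empty]
  · intro I _ hI
    have : I.card ≠ 0 := by simpa using hI
    simp [cL, this, hI]
  · simp

lemma tL_move (h : Rel c x a b d e) {U V I J : Finset ι} {w : ι} (hJ : J ⊆ V) (hw : w ∉ V) :
    d w * tL c x a b d e U V I J = (∏ j ∈ J, F c x j w) • tL c x a b d e U (insert w V) I J +
      ∑ y ∈ J, (G c x w y * ∏ k ∈ J.erase y, G c x k y) •
        (b w * tL c x a b d e U V I (J.erase y)) := by
  have hwJ : w ∉ J := fun hh => hw (hJ hh)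
  have e1 : insert w V \ J = insert w (V \ J) := Finset.insert_sdiff_of_notMem _ hwJ
  have hw' : w ∉ V \ J := fun hh => hw (Finset.mem_sdiff.1 hh).1
  have e2 : ∀ y ∈ J, tL c x a b d e U V I (J.erase y) =
      P (H c x) b (J.erase y) * (d y * P1 d (V \ J)) * P (H c x) a (U \ I) * P1 e I := by
    intro y hy
    have : V \ J.erase y = insert y (V \ J) := by
      rw [Finset.sdiff_erase (hJ hy)]
    rw [tL, this, P1_insert h.dd (by simp [hy])]
  rw [Finset.sum_congr rfl fun y hy => by rw [e2 y hy]]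
  rw [tL, tL, e1, P1_insert h.dd hw', ← mul_assoc, ← mul_assoc, ← mul_assoc,
    move h.good h.bb h.db J w hwJ]
  simp only [add_mul, smul_mul_assoc, Finset.sum_mul, mul_assoc]

lemma tL_ins (h : Rel c x a b d e) {U V I J : Finset ι} {w : ι} (hJ : J ⊆ V) (hw : w ∉ V) :
    tL c x a b d e U (insert w V) I (insert w J) =
      (∏ y ∈ J, H c x y w)⁻¹ • (b w * tL c x a b d e U V I J) := by
  have hwJ : w ∉ J := fun hh => hw (hJ hh)
  have e1 : insert w V \ insert w J = V \ J := by
    rw [Finset.insert_sdiff_insert, Finset.sdiff_insert_of_notMem hw]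
  rw [tL, e1, P_insert h.bb hwJ, tL]
  simp only [smul_mul_assoc, mul_assoc]

lemma tL_e (h : Rel c x a b d e) {U V I J : Finset ι} {i : ι} (hi : i ∈ I) :
    tL c x a b d e (U.erase i) V (I.erase i) J * e i = tL c x a b d e U V I J := by
  have e1 : U.erase i \ I.erase i = U \ I := by
    ext k; simp only [Finset.mem_sdiff, Finset.mem_erase]
    constructor
    · rintro ⟨⟨h1, h2⟩, h3⟩; exact ⟨h2, fun h4 => h3 ⟨h1, h4⟩⟩
    · rintro ⟨h1, h2⟩
      exact ⟨⟨by rintro rfl; exact h2 hi, h1⟩, fun h3 => h2 h3.2⟩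
  rw [tL, e1, tL, P1_erase h.ee hi, P1_comm h.ee]
  simp only [mul_assoc]

lemma cL_id (hg : Good c x) {U V I J : Finset ι} {w : ι} (hI : I ⊆ U) (hJ : J ⊆ V)
    (hUV : Disjoint U V) (hwU : w ∉ U) (hw : w ∉ V) :
    cL c x U (insert w V) I (insert w J) * (∏ y ∈ J, H c x y w)⁻¹ =
      ∑ y ∈ V \ J, (cL c x U V I (insert y J) * (G c x w y * ∏ k ∈ J, G c x k y)) +
      ∑ i ∈ I, gam c x w U V i * cL c x (U.erase i) V (I.erase i) J := by
  have hwJ : w ∉ J := fun hh => hw (hJ hh)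
  by_cases hc : I.card = J.card + 1
  · have e1 : insert w V \ insert w J = V \ J := by
      rw [Finset.insert_sdiff_insert, Finset.sdiff_insert_of_notMem hw]
    have hp := pf hg I (V \ J) J w
      (Finset.disjoint_of_subset_left hI (Finset.disjoint_of_subset_right Finset.sdiff_subset hUV))
      (fun hh => hwU (hI hh)) (fun hh => hw (Finset.mem_sdiff.1 hh).1) hc
    have hH := Hp_ne hg hwJ
    have t1 : cL c x U (insert w V) I (insert w J) * (∏ y ∈ J, H c x y w)⁻¹ =
        (dp (G c x) I J * dp (F c x) J (V \ J) * dp (G c x) (U \ I) I * hne c x J) *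
        ((∏ i ∈ I, G c x i w) * (∏ j ∈ V \ J, F c x w j) * ∏ j ∈ J, H c x w j) := by
      rw [cL, if_pos (by rw [hc, Finset.card_insert_of_notMem hwJ]), e1,
        dp_insert_right _ _ hwJ, dp_insert_left _ _ hwJ, hne_insert _ _ hwJ]
      field_simp
    rw [t1, hp, mul_add, Finset.mul_sum, Finset.mul_sum]
    congr 1
    · refine Finset.sum_congr rfl fun y hy => ?_
      have hyJ := (Finset.mem_sdiff.1 hy).2
      rw [cL, if_pos (by rw [hc, Finset.card_insert_of_notMem hyJ]), Finset.sdiff_insert,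
        dp_insert_right _ _ hyJ, dp_insert_left _ _ hyJ, hne_insert _ _ hyJ,
        dp_erase_right (F c x) J hy, ← GHp hg J y]
      ring
    · refine Finset.sum_congr rfl fun i hi => ?_
      have e2 : U.erase i \ I.erase i = U \ I := by
        ext k; simp only [Finset.mem_sdiff, Finset.mem_erase]
        constructor
        · rintro ⟨⟨h1, h2⟩, h3⟩; exact ⟨h2, fun h4 => h3 ⟨h1, h4⟩⟩
        · rintro ⟨h1, h2⟩
          exact ⟨⟨by rintro rfl; exact h2 hi, h1⟩, fun h3 => h2 h3.2⟩
      have e3 : ∏ k ∈ U.erase i, G c x k i =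
          (∏ k ∈ U \ I, G c x k i) * ∏ k ∈ I.erase i, G c x k i := by
        rw [← e2, Finset.prod_sdiff (Finset.erase_subset_erase i hI)]
      have e4 : ∏ j ∈ V, F c x i j = (∏ j ∈ V \ J, F c x i j) *
          ((∏ j ∈ J, G c x i j) * ∏ j ∈ J, H c x i j) := by
        rw [← Finset.prod_sdiff hJ, ← Finset.prod_mul_distrib]
        congr 1
        exact Finset.prod_congr rfl fun j _ => (GH hg i j).symm
      rw [cL, if_pos (by rw [Finset.card_erase_of_mem hi, hc]; rfl), e2, gam, e3, e4,
        dp_erase_left (G c x) J hi, dp_erase_right (G c x) (U \ I) hi]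
      ring
  · rw [cL, if_neg (by rw [Finset.card_insert_of_notMem hwJ]; exact hc), zero_mul]
    rw [Finset.sum_eq_zero, Finset.sum_eq_zero, add_zero]
    · intro i hi
      rw [cL, if_neg, mul_zero]
      rw [Finset.card_erase_of_mem hi]
      have := Finset.card_pos.2 ⟨i, hi⟩
      omega
    · intro y hy
      have hyJ := (Finset.mem_sdiff.1 hy).2
      rw [cL, if_neg (by rw [Finset.card_insert_of_notMem hyJ]; exact hc), zero_mul]

lemma Lv (h : Rel c x a b d e) {U V : Finset ι} {w : ι} (hUV : Disjoint U V) (hwU : w ∉ U)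
    (hw : w ∉ V) :
    Lf c x a b d e U (insert w V) = d w * Lf c x a b d e U V +
      b w * ∑ i ∈ U, gam c x w U V i • (Lf c x a b d e (U.erase i) V * e i) := by
  have hg := h.good
  have s1 : d w * Lf c x a b d e U V = ∑ I ∈ U.powerset, ∑ J ∈ V.powerset,
      (cL c x U V I J * (∏ j ∈ J, F c x j w)) • tL c x a b d e U (insert w V) I J +
      ∑ I ∈ U.powerset, ∑ J ∈ V.powerset, ∑ y ∈ V \ J,
        (cL c x U V I (insert y J) * (G c x w y * ∏ k ∈ J, G c x k y)) •
        (b w * tL c x a b d e U V I J) := by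
    rw [Lf, Finset.mul_sum, ← Finset.sum_add_distrib]
    refine Finset.sum_congr rfl fun I _ => ?_
    rw [← reindex1, ← Finset.sum_add_distrib, Finset.mul_sum]
    refine Finset.sum_congr rfl fun J hJ => ?_
    rw [mul_smul_comm, tL_move h (Finset.mem_powerset.1 hJ) hw, smul_add, smul_smul,
      Finset.smul_sum]
    congr 1
    refine Finset.sum_congr rfl fun y hy => ?_
    rw [Finset.insert_erase hy, smul_smul]
  have s2 : b w * ∑ i ∈ U, gam c x w U V i • (Lf c x a b d e (U.erase i) V * e i) =
      ∑ I ∈ U.powerset, ∑ J ∈ V.powerset, ∑ i ∈ I,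
        (gam c x w U V i * cL c x (U.erase i) V (I.erase i) J) •
          (b w * tL c x a b d e U V I J) := by
    have : ∀ i ∈ U, gam c x w U V i • (Lf c x a b d e (U.erase i) V * e i) =
        ∑ I ∈ (U.erase i).powerset, ∑ J ∈ V.powerset,
          (gam c x w U V i * cL c x (U.erase i) V I J) •
            (tL c x a b d e (U.erase i) V I J * e i) := by
      intro i _
      simp only [Lf, Finset.sum_mul, Finset.smul_sum, smul_smul, smul_mul_assoc]
    rw [Finset.sum_congr rfl this, reindex3 U (fun i I => ∑ J ∈ V.powerset,
          (gam c x w U V i * cL c x (U.erase i) V I J) •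
            (tL c x a b d e (U.erase i) V I J * e i)), Finset.mul_sum]
    refine Finset.sum_congr rfl fun I _ => ?_
    rw [Finset.sum_comm, Finset.mul_sum]
    refine Finset.sum_congr rfl fun J _ => ?_
    rw [Finset.mul_sum]
    refine Finset.sum_congr rfl fun i hi => ?_
    rw [tL_e h hi, mul_smul_comm]
  rw [s1, s2, Lf, add_assoc, ← Finset.sum_add_distrib, ← Finset.sum_add_distrib]
  refine Finset.sum_congr rfl fun I hI => ?_
  rw [Finset.sum_powerset_insert hw]
  congr 1
  · refine Finset.sum_congr rfl fun J hJ => ?_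
    have hwJ : w ∉ J := fun hh => hw (Finset.mem_powerset.1 hJ hh)
    have hw' : w ∉ V \ J := fun hh => hw (Finset.mem_sdiff.1 hh).1
    congr 1
    rw [cL, cL, Finset.insert_sdiff_of_notMem _ hwJ, dp_insert_right _ _ hw']
    split_ifs
    · ring
    · ring
  · rw [← Finset.sum_add_distrib]
    refine Finset.sum_congr rfl fun J hJ => ?_
    rw [tL_ins h (Finset.mem_powerset.1 hJ) hw, smul_smul,
      cL_id hg (Finset.mem_powerset.1 hI) (Finset.mem_powerset.1 hJ) hUV hwU hw, add_smul,
      Finset.sum_smul, Finset.sum_smul]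

end left

section link

variable {ι : Type*} [DecidableEq ι]
variable {c : ℂ} {x : ι → ℂ} {a b d e : ι → A}

lemma dswap {B : Type*} [AddCommMonoid B] (U : Finset ι) (Φ : ι → ι → B) :
    ∑ i ∈ U, ∑ k ∈ U.erase i, Φ i k = ∑ i ∈ U, ∑ k ∈ U.erase i, Φ k i := by
  refine Finset.sum_comm' ?_
  intro i k
  simp only [Finset.mem_erase]
  tauto

lemma gam_insert {U V : Finset ι} {w z i : ι} (hz : z ∉ V) :
    gam c x w U (insert z V) i = gam c x w U V i * F c x i z := by
  rw [gam, gam, Finset.prod_insert hz]; ring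

lemma link_scalar (hg : Good c x) {U V : Finset ι} {w z i k : ι} (hw : w ∉ V) (hz : z ∉ V)
    (hi : i ∈ U) (hk : k ∈ U.erase i) (hwU : w ∉ U) (hzU : z ∉ U) (hzw : z ≠ w) :
    gam c x z U (insert w V) i * gam c x w (U.erase i) V k =
      gam c x w U (insert z V) k * gam c x z (U.erase k) V i * (H c x z k * (H c x k z)⁻¹)
      + gam c x z U V i * G c x i w * gam c x i (U.erase i) V k
      - gam c x z U V k * G c x k w * gam c x k (U.erase k) V i := by
  have hki : k ≠ i := Finset.ne_of_mem_erase hk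
  have hkU : k ∈ U := Finset.mem_of_mem_erase hk
  have hi' : i ∈ U.erase k := Finset.mem_erase.2 ⟨hki.symm, hi⟩
  have hiw := ne_of_mem_notMem hi hwU
  have hiz := ne_of_mem_notMem hi hzU
  have hkw := ne_of_mem_notMem hkU hwU
  have hkz := ne_of_mem_notMem hkU hzU
  rw [gam_insert hw, gam_insert hz]
  simp only [gam]
  rw [← Finset.mul_prod_erase (U.erase i) (fun l => G c x l i) hk,
    ← Finset.mul_prod_erase (U.erase k) (fun l => G c x l k) hi', Finset.erase_right_comm (a := k)]
  have h1 : F c x k z * (H c x z k * (H c x k z)⁻¹) = - F c x z k := by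
    rw [← GH hg k z, ← GH hg z k, G_anti c x z k]
    have := H_ne hg hkz
    field_simp
  have h2 : G c x i z * G c x k w * (F c x i w - F c x z k) +
      G c x k i * (G c x k z * G c x k w - G c x i z * G c x i w) = 0 := by
    rw [F_eq hg hiw, F_eq hg hkz.symm]
    unfold G gg
    have s1 := sub_ne_zero.2 (hg.ne i z hiz)
    have s2 := sub_ne_zero.2 (hg.ne k w hkw)
    have s3 := sub_ne_zero.2 (hg.ne i w hiw)
    have s4 := sub_ne_zero.2 (hg.ne k z hkz)
    have s5 := sub_ne_zero.2 (hg.ne k i hki)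
    have s6 := sub_ne_zero.2 (hg.ne z k hkz.symm)
    rw [← neg_sub (x k) (x z)]
    field_simp
    ring
  have h3 : G c x i k = - G c x k i := G_anti c x k i
  rw [h3]
  linear_combination (norm := (ring_nf)) (G c x k i * (∏ l ∈ (U.erase i).erase k, G c x l i) *
    (∏ l ∈ (U.erase i).erase k, G c x l k) * (∏ j ∈ V, F c x i j) * (∏ j ∈ V, F c x k j)) *
    (h2 + G c x i z * G c x k w * h1)

theorem link (h : Rel c x a b d e) (B : Finset ι → Finset ι → A)
    (hB0 : ∀ U, B U ∅ = P (H c x) a U)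
    (hLv : ∀ U V w, Disjoint U V → w ∉ U → w ∉ V → B U (insert w V) = d w * B U V +
      b w * ∑ i ∈ U, gam c x w U V i • (B (U.erase i) V * e i)) (V : Finset ι) :
    ∀ U w, Disjoint U V → w ∉ U → w ∉ V → B U (insert w V) = B U V * d w +
      ∑ i ∈ U, gam c x w U V i • (b i * B (U.erase i) V * e w) := by
  have hg := h.good
  induction V using Finset.induction_on with
  | empty =>
    intro U w _ hw _
    rw [hLv U ∅ w (by simp) hw (by simp), hB0, baseC h U w hw, Finset.mul_sum, add_assoc,
      ← Finset.sum_add_distrib]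
    congr 1
    refine Finset.sum_congr rfl fun i _ => ?_
    simp only [gam, Finset.prod_empty, mul_one, hB0, smul_sub, mul_smul_comm, mul_assoc]
    abel
  | insert z V hz ih =>
    intro U w hd hwU hw
    have hzw : z ≠ w := by rintro rfl; simp at hw
    have hwV : w ∉ V := fun hh => hw (Finset.mem_insert_of_mem hh)
    have hd' : Disjoint U V := Finset.disjoint_of_subset_right (Finset.subset_insert _ _) hd
    have hzU : z ∉ U := fun hh => Finset.disjoint_left.1 hd hh (Finset.mem_insert_self _ _)
    have hde : ∀ i, Disjoint (U.erase i) V := fun i =>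
      Finset.disjoint_of_subset_left (Finset.erase_subset _ _) hd'
    have hUw : Disjoint U (insert w V) := by
      rw [Finset.disjoint_insert_right]; exact ⟨hwU, hd'⟩
    have hzw' : z ∉ insert w V := by simp [hzw, hz]
    have hC : ∀ i ∈ U, d i * B (U.erase i) V = B (U.erase i) V * d i +
        ∑ k ∈ U.erase i, gam c x i (U.erase i) V k •
          (b k * B ((U.erase i).erase k) V * e i - b i * B ((U.erase i).erase k) V * e k) := by
      intro i hi
      have hiV : i ∉ V := fun hh => Finset.disjoint_left.1 hd' hi hh
      have h1 := ih (U.erase i) i (hde i) (Finset.notMem_erase _ _) hiV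
      rw [hLv (U.erase i) V i (hde i) (Finset.notMem_erase _ _) hiV] at h1
      rw [eq_sub_of_add_eq h1, Finset.mul_sum, add_sub_assoc, ← Finset.sum_sub_distrib]
      congr 1
      refine Finset.sum_congr rfl fun k _ => ?_
      simp only [smul_sub, mul_smul_comm, mul_assoc]
    have hbb : ∀ k ∈ U, b k * b z = (H c x z k * (H c x k z)⁻¹) • (b z * b k) := by
      intro k hk
      have hkz := ne_of_mem_notMem hk hzU
      have := h.bb k z hkz
      rw [mul_smul, ← this, smul_smul, mul_inv_cancel₀ (H_ne hg hkz.symm), one_smul]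
    have hS : ∀ i ∈ U, gam c x w U V i • (d z * b i * B (U.erase i) V * e w) +
        (gam c x z U V i * F c x i w) • (b z * B (U.erase i) V * d w * e i) =
        gam c x w U (insert z V) i • (b i * d z * B (U.erase i) V * e w) +
        gam c x z U V i • (b z * B (U.erase i) V * e i * d w) -
        ∑ k ∈ U.erase i, (gam c x z U V i * G c x i w * gam c x i (U.erase i) V k) •
          (b z * b k * B ((U.erase i).erase k) V * e i * e w) +
        ∑ k ∈ U.erase i, (gam c x z U V i * G c x i w * gam c x i (U.erase i) V k) •
          (b z * b i * B ((U.erase i).erase k) V * e k * e w) := by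
      intro i hi
      have hiw := ne_of_mem_notMem hi hwU
      have hiz := ne_of_mem_notMem hi hzU
      have q1 : b z * d i * B (U.erase i) V * e w = b z * B (U.erase i) V * d i * e w +
          ∑ k ∈ U.erase i, (gam c x i (U.erase i) V k •
            (b z * b k * B ((U.erase i).erase k) V * e i * e w)
            - gam c x i (U.erase i) V k • (b z * b i * B ((U.erase i).erase k) V * e k * e w)) := by
        rw [mul_assoc (b z), hC i hi, mul_add, add_mul, Finset.mul_sum, Finset.sum_mul]
        simp only [mul_assoc, mul_smul_comm, smul_mul_assoc, mul_sub, sub_mul, smul_sub]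
      have q2 : b z * B (U.erase i) V * e i * d w =
          F c x i w • (b z * B (U.erase i) V * d w * e i) +
          G c x w i • (b z * B (U.erase i) V * d i * e w) := by
        rw [mul_assoc _ (e i), h.ed i w hiw, mul_add, mul_smul_comm, mul_smul_comm]
        simp only [mul_assoc]
      have q3 : d z * b i * B (U.erase i) V * e w =
          F c x i z • (b i * d z * B (U.erase i) V * e w) +
          G c x z i • (b z * d i * B (U.erase i) V * e w) := by
        rw [h.db z i hiz.symm]
        simp only [add_mul, smul_mul_assoc]
      rw [q3, q2, q1, gam_insert hz, Finset.sum_sub_distrib]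
      simp only [mul_smul, ← Finset.smul_sum]
      have k1 : G c x w i = - G c x i w := G_anti c x i w
      have k2 : gam c x w U V i * G c x z i = - (gam c x z U V i * G c x i w) := by
        simp only [gam]; rw [G_anti c x i z]; ring
      have k3 : ∀ y : A, gam c x w U V i • G c x z i • y
          = - (gam c x z U V i • G c x i w • y) := by
        intro y; rw [smul_smul, k2, neg_smul, mul_smul]
      simp only [smul_add, k1, k3, smul_sub, neg_smul, smul_neg]
      abel
    have hL : B U (insert w (insert z V)) = d z * B U V * d w +
        ∑ i ∈ U, (gam c x w U V i • (d z * b i * B (U.erase i) V * e w) +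
          (gam c x z U V i * F c x i w) • (b z * B (U.erase i) V * d w * e i)) +
        ∑ i ∈ U, ∑ k ∈ U.erase i,
          (gam c x z U (insert w V) i * gam c x w (U.erase i) V k) •
            (b z * b k * B ((U.erase i).erase k) V * e i * e w) := by
      rw [Finset.insert_comm, hLv U (insert w V) z hUw hzU hzw', ih U w hd' hwU hwV, mul_add,
        Finset.mul_sum, Finset.mul_sum, Finset.sum_add_distrib, add_assoc, add_assoc, mul_assoc,
        add_assoc, ← Finset.sum_add_distrib (f := fun i => (gam c x z U V i * F c x i w) • _)]
      congr 2
      · refine Finset.sum_congr rfl fun i _ => ?_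
        simp only [mul_smul_comm, mul_assoc]
      · refine Finset.sum_congr rfl fun i _ => ?_
        rw [ih (U.erase i) w (hde i) (fun hh => hwU (Finset.mem_of_mem_erase hh)) hwV,
          add_mul, smul_add, mul_add, Finset.sum_mul, Finset.smul_sum, Finset.mul_sum]
        congr 1
        · rw [gam_insert hwV]; simp only [mul_smul_comm, mul_assoc]
        · refine Finset.sum_congr rfl fun k _ => ?_
          simp only [smul_mul_assoc, mul_smul_comm, mul_assoc, smul_smul, h.ee w i]
    have hR : B U (insert z V) * d w +
        ∑ i ∈ U, gam c x w U (insert z V) i • (b i * B (U.erase i) (insert z V) * e w) =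
        d z * B U V * d w +
        ∑ i ∈ U, (gam c x w U (insert z V) i • (b i * d z * B (U.erase i) V * e w) +
        gam c x z U V i • (b z * B (U.erase i) V * e i * d w)) +
        ∑ i ∈ U, ∑ k ∈ U.erase i,
          (gam c x w U (insert z V) k * gam c x z (U.erase k) V i *
            (H c x z k * (H c x k z)⁻¹)) •
            (b z * b k * B ((U.erase i).erase k) V * e i * e w) := by
      rw [dswap U (fun i k => (gam c x w U (insert z V) k * gam c x z (U.erase k) V i *
            (H c x z k * (H c x k z)⁻¹)) •
            (b z * b k * B ((U.erase i).erase k) V * e i * e w)),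
        hLv U V z hd' hzU hz, add_mul, Finset.mul_sum, Finset.sum_mul, Finset.sum_add_distrib,
        add_assoc, add_assoc, add_assoc, add_left_comm]
      have r1 : ∑ i ∈ U, b z * gam c x z U V i • (B (U.erase i) V * e i) * d w =
          ∑ i ∈ U, gam c x z U V i • (b z * B (U.erase i) V * e i * d w) := by
        refine Finset.sum_congr rfl fun i _ => ?_
        simp only [mul_smul_comm, smul_mul_assoc, mul_assoc]
      rw [r1]
      simp only [add_left_comm _ (∑ i ∈ U, gam c x z U V i • (b z * B (U.erase i) V * e i * d w))]
      congr 2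
      · rw [← Finset.sum_add_distrib]
        refine Finset.sum_congr rfl fun i hi => ?_
        rw [hLv (U.erase i) V z (hde i) (fun hh => hzU (Finset.mem_of_mem_erase hh)) hz,
          mul_add, add_mul, smul_add, Finset.mul_sum, Finset.mul_sum, Finset.sum_mul,
          Finset.smul_sum]
        congr 1
        · simp only [mul_assoc]
        · refine Finset.sum_congr rfl fun k _ => ?_
          have q : (H c x z i * (H c x i z)⁻¹) •
              (b z * b i * B ((U.erase i).erase k) V * e k * e w) =
              b i * b z * B ((U.erase i).erase k) V * e k * e w := by
            rw [hbb i hi]; simp only [smul_mul_assoc]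
          rw [Finset.erase_right_comm (a := k), mul_smul (_ * _) (_ * _), q]
          simp only [smul_mul_assoc, mul_smul_comm, mul_assoc, smul_smul]
    rw [hL, hR, Finset.sum_congr rfl hS, Finset.sum_add_distrib, Finset.sum_sub_distrib]
    rw [dswap U (fun i k => (gam c x z U V i * G c x i w * gam c x i (U.erase i) V k) •
          (b z * b i * B ((U.erase i).erase k) V * e k * e w))]
    have hfin : ∑ i ∈ U, ∑ k ∈ U.erase i,
          (gam c x z U (insert w V) i * gam c x w (U.erase i) V k) •
            (b z * b k * B ((U.erase i).erase k) V * e i * e w) =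
        ∑ i ∈ U, ∑ k ∈ U.erase i,
          (gam c x w U (insert z V) k * gam c x z (U.erase k) V i *
            (H c x z k * (H c x k z)⁻¹)) •
            (b z * b k * B ((U.erase i).erase k) V * e i * e w) +
        ∑ i ∈ U, ∑ k ∈ U.erase i,
          (gam c x z U V i * G c x i w * gam c x i (U.erase i) V k) •
            (b z * b k * B ((U.erase i).erase k) V * e i * e w) -
        ∑ i ∈ U, ∑ k ∈ U.erase i,
          (gam c x z U V k * G c x k w * gam c x k (U.erase k) V i) •
            (b z * b k * B ((U.erase k).erase i) V * e i * e w) := by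
      rw [← Finset.sum_add_distrib, ← Finset.sum_sub_distrib]
      refine Finset.sum_congr rfl fun i hi => ?_
      rw [← Finset.sum_add_distrib, ← Finset.sum_sub_distrib]
      refine Finset.sum_congr rfl fun k hk => ?_
      rw [Finset.erase_right_comm (a := k), ← add_smul, ← sub_smul,
        link_scalar hg hwV hz hi hk hwU hzU hzw]
    rw [hfin]
    abel

/-- a family is determined by the right recursion and the initial value -/
theorem uniq (B B' : Finset ι → Finset ι → A) (hB0 : ∀ U, B U ∅ = B' U ∅)
    (hB : ∀ V U w, Disjoint U V → w ∉ U → w ∉ V → B U (insert w V) = B U V * d w +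
      ∑ i ∈ U, gam c x w U V i • (b i * B (U.erase i) V * e w))
    (hB' : ∀ V U w, Disjoint U V → w ∉ U → w ∉ V → B' U (insert w V) = B' U V * d w +
      ∑ i ∈ U, gam c x w U V i • (b i * B' (U.erase i) V * e w)) (V : Finset ι) :
    ∀ U, Disjoint U V → B U V = B' U V := by
  induction V using Finset.induction_on with
  | empty => intro U _; exact hB0 U
  | insert w V hw ih =>
    intro U hd
    rw [Finset.disjoint_insert_right] at hd
    rw [hB V U w hd.2 hd.1 hw, hB' V U w hd.2 hd.1 hw, ih U hd.2]
    congr 1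
    refine Finset.sum_congr rfl fun i _ => ?_
    rw [ih _ (Finset.disjoint_of_subset_left (Finset.erase_subset _ _) hd.2)]

end link

section kernel

variable {ι : Type*} [DecidableEq ι] {c : ℂ} {x : ι → ℂ}

/-- Vandermonde type product -/
def vdm {n : ℕ} (Q : Fin n → Fin n → ℂ) : ℂ :=
  ∏ j : Fin n, ∏ k : Fin n, if (k : ℕ) < (j : ℕ) then Q j k else 1

lemma sign_prod (n i : ℕ) (hi : i ≤ n) :
    ∏ k : Fin n, (if (k : ℕ) < i then (-1 : ℂ) else 1) = (-1) ^ i := by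
  rw [Fin.prod_univ_eq_prod_range (fun k => if k < i then (-1 : ℂ) else 1) n,
    ← Finset.prod_filter, Finset.prod_const]
  congr 1
  have : (Finset.range n).filter (fun k => k < i) = Finset.range i := by
    ext k; simp; omega
  rw [this, Finset.card_range]

lemma vdm_succAbove {n : ℕ} (Q : Fin (n + 1) → Fin (n + 1) → ℂ) (hQ : ∀ j k, Q j k = - Q k j)
    (i : Fin (n + 1)) :
    vdm Q = (-1) ^ (i : ℕ) * (∏ k : Fin n, Q (i.succAbove k) i) *
      vdm (fun j k => Q (i.succAbove j) (i.succAbove k)) := by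
  have hlt : ∀ j k : Fin n, ((i.succAbove k : Fin (n+1)) : ℕ) < (i.succAbove j : Fin (n+1)) ↔
      (k : ℕ) < j := by
    intro j k
    rw [← Fin.lt_def, Fin.succAbove_lt_succAbove_iff, Fin.lt_def]
  rw [vdm, Fin.prod_univ_succAbove _ i, Fin.prod_univ_succAbove _ i]
  simp only [lt_irrefl, if_false, one_mul]
  have : ∀ j : Fin n, (∏ k : Fin (n + 1), if (k : ℕ) < (i.succAbove j : Fin (n+1)) then
      Q (i.succAbove j) k else 1) =
      (if (i : ℕ) < (i.succAbove j : Fin (n+1)) then Q (i.succAbove j) i else 1) *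
      ∏ k : Fin n, if (k : ℕ) < j then Q (i.succAbove j) (i.succAbove k) else 1 := by
    intro j
    rw [Fin.prod_univ_succAbove _ i]
    simp only [hlt]
  rw [Finset.prod_congr rfl fun j _ => this j, Finset.prod_mul_distrib, ← mul_assoc,
    ← Finset.prod_mul_distrib]
  unfold vdm
  congr 1
  rw [← sign_prod n i (by omega), ← Finset.prod_mul_distrib]
  refine Finset.prod_congr rfl fun k _ => ?_
  have h1 : ((i.succAbove k : Fin (n+1)) : ℕ) < i ↔ (k : ℕ) < i := by
    rw [← Fin.lt_def, Fin.succAbove_lt_iff_castSucc_lt]; rfl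
  have h2 : (i : ℕ) < (i.succAbove k : Fin (n+1)) ↔ ¬ (k : ℕ) < i := by
    rw [← h1]
    have : ((i.succAbove k : Fin (n+1)) : ℕ) ≠ i := fun hh => Fin.succAbove_ne i k (Fin.ext hh)
    omega
  by_cases hk : (k : ℕ) < i
  · simp only [h1, h2, hk, if_true, not_true, if_false]
    rw [hQ]; ring
  · simp only [h1, h2, hk, if_false, not_false_iff, if_true]

lemma vdm_succ {n : ℕ} (Q : Fin (n + 1) → Fin (n + 1) → ℂ) :
    vdm Q = (∏ k : Fin n, Q k.succ 0) * vdm (fun j k => Q j.succ k.succ) := by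
  rw [vdm, Fin.prod_univ_succ]
  simp only [Fin.prod_univ_succ (n := n), Fin.val_zero, Fin.val_succ, Nat.not_lt_zero, if_false,
    Finset.prod_const_one, one_mul, Nat.succ_pos, if_true, Nat.add_lt_add_iff_right]
  rw [Finset.prod_mul_distrib]; rfl

/-- Izergin kernel in indexed form -/
def Kp (c : ℂ) (x : ι → ℂ) {n : ℕ} (p q : Fin n → ι) : ℂ :=
  vdm (fun j k => G c x (p j) (p k)) * vdm (fun j k => G c x (q k) (q j)) *
    (∏ j, ∏ k, H c x (p j) (q k)) *
    Matrix.det (Matrix.of fun j k => G c x (p j) (q k) / H c x (p j) (q k))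

lemma Kiz_eq_Kp {n : ℕ} (p q : Fin n → ι) :
    Kiz c (fun j => x (p j)) (fun j => x (q j)) = Kp c x p q := rfl

lemma lap (hg : Good c x) {n : ℕ} (p : Fin (n + 1) → ι) (q : Fin n → ι) (y : ι)
    (hy : ∀ i, p i ≠ y) :
    ∑ i : Fin (n + 1), G c x (p i) y * (∏ k, G c x (p (i.succAbove k)) (p i)) *
      (∏ l, H c x (p i) (q l)) * (∏ k, H c x (p (i.succAbove k)) y) *
      Kp c x (fun k => p (i.succAbove k)) q =
    vdm (fun j k => G c x (p j) (p k)) * vdm (fun j k => G c x (q k) (q j)) *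
      (∏ j, ∏ k, H c x (p j) (q k)) * (∏ k, H c x (p k) y) *
      Matrix.det (Matrix.of fun j k => G c x (p j) ((Fin.cons y q : Fin (n + 1) → ι) k) /
        H c x (p j) ((Fin.cons y q : Fin (n + 1) → ι) k)) := by
  rw [Matrix.det_succ_column_zero, Finset.mul_sum]
  refine Finset.sum_congr rfl fun i _ => ?_
  rw [vdm_succAbove (fun j k => G c x (p j) (p k)) (fun j k => G_anti c x (p k) (p j)) i, Kp,
    Fin.prod_univ_succAbove (fun j => ∏ k, H c x (p j) (q k)) i,
    Fin.prod_univ_succAbove (fun k => H c x (p k) y) i]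
  have hH := H_ne hg (hy i)
  have hs : ((-1 : ℂ) ^ (i : ℕ)) * ((-1 : ℂ) ^ (i : ℕ)) = 1 := by
    rw [← mul_pow]; norm_num
  have hm : (Matrix.of fun j k => G c x (p j) ((Fin.cons y q : Fin (n + 1) → ι) k) /
        H c x (p j) ((Fin.cons y q : Fin (n + 1) → ι) k)).submatrix i.succAbove Fin.succ =
      Matrix.of fun j k => G c x (p (i.succAbove j)) (q k) / H c x (p (i.succAbove j)) (q k) := by
    ext j k; simp
  rw [hm]
  simp only [Matrix.of_apply, Fin.cons_zero]
  generalize Matrix.det (Matrix.of fun j k => G c x (p (i.succAbove j)) (q k) /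
    H c x (p (i.succAbove j)) (q k)) = D
  generalize vdm (fun j k => G c x (p (i.succAbove j)) (p (i.succAbove k))) = v1
  generalize vdm (fun j k => G c x (q k) (q j)) = v2
  field_simp
  rw [pow_two, hs, mul_one]

lemma lap_zero (hg : Good c x) {n : ℕ} (p : Fin (n + 1) → ι) (q : Fin n → ι) (m : Fin n)
    (hy : ∀ i, p i ≠ q m) :
    ∑ i : Fin (n + 1), G c x (p i) (q m) * (∏ k, G c x (p (i.succAbove k)) (p i)) *
      (∏ l, H c x (p i) (q l)) * (∏ k, H c x (p (i.succAbove k)) (q m)) *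
      Kp c x (fun k => p (i.succAbove k)) q = 0 := by
  rw [lap hg p q (q m) hy, Matrix.det_zero_of_column_eq (i := 0) (j := m.succ)
    (Fin.succ_ne_zero m).symm, mul_zero]
  intro k; simp

lemma Kp_cons (hg : Good c x) {n : ℕ} (p : Fin (n + 1) → ι) (q : Fin n → ι) (w : ι)
    (hw : ∀ i, p i ≠ w) :
    Kp c x p (Fin.cons w q) = (∏ k, G c x w (q k)) *
      ∑ i : Fin (n + 1), G c x (p i) w * (∏ k, G c x (p (i.succAbove k)) (p i)) *
      (∏ l, H c x (p i) (q l)) * (∏ k, H c x (p (i.succAbove k)) w) *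
      Kp c x (fun k => p (i.succAbove k)) q := by
  rw [lap hg p q w hw, Kp, vdm_succ (fun j k => G c x ((Fin.cons w q : Fin (n + 1) → ι) k)
    ((Fin.cons w q : Fin (n + 1) → ι) j))]
  simp only [Fin.prod_univ_succ (n := n) (fun k => H c x _ ((Fin.cons w q : Fin (n + 1) → ι) k)),
    Fin.cons_zero, Fin.cons_succ, Finset.prod_mul_distrib]
  ring

lemma brk (hg : Good c x) {I J : Finset ι} {i w : ι} (hiJ : i ∉ J) (hwJ : w ∉ J) (hiw : i ≠ w)
    (hc : I.card = J.card) :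
    G c x i w * (∏ j ∈ J, G c x w j) * (∏ k ∈ I, H c x k w) =
      G c x i w * (∏ j ∈ J, G c x i j) * (∏ k ∈ I, H c x k i) +
      ∑ j ∈ J, G c x w j * (∏ l ∈ J.erase j, G c x j l) *
        (G c x i j * ∏ k ∈ I, H c x k j) := by
  have hp := pf hg.neg (insert i J) ∅ I w (by simp) (by simp [hiw.symm, hwJ]) (by simp)
    (by rw [Finset.card_insert_of_notMem hiJ, hc])
  simp only [G_neg, H_neg, F_neg] at hp
  simp only [Finset.prod_insert hiJ, Finset.sum_insert hiJ, Finset.erase_insert hiJ,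
    Finset.prod_empty, Finset.sum_empty, mul_one, zero_add] at hp
  have e : ∀ j ∈ J, G c x w j * ((∏ l ∈ (insert i J).erase j, G c x j l) * ∏ k ∈ I, H c x k j) =
      - (G c x w j * (∏ l ∈ J.erase j, G c x j l) * (G c x i j * ∏ k ∈ I, H c x k j)) := by
    intro j hj
    have hji := ne_of_mem_notMem hj hiJ
    rw [Finset.erase_insert_of_ne hji.symm,
      Finset.prod_insert (fun hh => hiJ (Finset.mem_of_mem_erase hh)), G_anti c x i j]
    ring
  rw [Finset.sum_congr rfl e, Finset.sum_neg_distrib, G_anti c x i w] at hp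
  linear_combination -hp

lemma Kp_rec (hg : Good c x) {n : ℕ} (p : Fin (n + 1) → ι) (q : Fin n → ι) (w : ι)
    (hp : Function.Injective p) (hq : Function.Injective q) (hpq : ∀ i j, p i ≠ q j)
    (hw : ∀ i, p i ≠ w) (hwq : ∀ j, q j ≠ w) :
    Kp c x p (Fin.cons w q) = ∑ i : Fin (n + 1), G c x (p i) w * (∏ j, F c x (p i) (q j)) *
      (∏ k, F c x (p (i.succAbove k)) (p i)) * Kp c x (fun k => p (i.succAbove k)) q := by
  rw [Kp_cons hg p q w hw, Finset.mul_sum]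
  have hterm : ∀ i : Fin (n + 1), (∏ k, G c x w (q k)) *
      (G c x (p i) w * (∏ k, G c x (p (i.succAbove k)) (p i)) *
      (∏ l, H c x (p i) (q l)) * (∏ k, H c x (p (i.succAbove k)) w) *
      Kp c x (fun k => p (i.succAbove k)) q) =
      G c x (p i) w * (∏ j, F c x (p i) (q j)) *
      (∏ k, F c x (p (i.succAbove k)) (p i)) * Kp c x (fun k => p (i.succAbove k)) q +
      ∑ m : Fin n, (G c x w (q m) * ∏ l ∈ (Finset.univ.image q).erase (q m), G c x (q m) l) *
       (G c x (p i) (q m) * (∏ k, G c x (p (i.succAbove k)) (p i)) *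
      (∏ l, H c x (p i) (q l)) * (∏ k, H c x (p (i.succAbove k)) (q m)) *
      Kp c x (fun k => p (i.succAbove k)) q) := by
    intro i
    have hs : Function.Injective (fun k => p (i.succAbove k)) :=
      hp.comp Fin.succAbove_right_injective
    have hb := brk hg (I := Finset.univ.image (fun k => p (i.succAbove k)))
      (J := Finset.univ.image q) (i := p i) (w := w) (by simp [fun j => (hpq i j).symm])
      (by simp [hwq]) (hw i)
      (by rw [Finset.card_image_of_injective _ hs, Finset.card_image_of_injective _ hq])
    simp only [Finset.prod_image (fun a _ b _ h => hs h), Finset.prod_image (fun a _ b _ h => hq h),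
      Finset.sum_image (fun a _ b _ h => hq h)] at hb
    have f1 : ∏ j, F c x (p i) (q j) = (∏ j, G c x (p i) (q j)) * ∏ j, H c x (p i) (q j) := by
      rw [← Finset.prod_mul_distrib]; exact Finset.prod_congr rfl fun j _ => (GH hg _ _).symm
    have f2 : ∏ k, F c x (p (i.succAbove k)) (p i) = (∏ k, G c x (p (i.succAbove k)) (p i)) *
        ∏ k, H c x (p (i.succAbove k)) (p i) := by
      rw [← Finset.prod_mul_distrib]; exact Finset.prod_congr rfl fun j _ => (GH hg _ _).symm
    rw [f1, f2]
    have : ∑ m : Fin n, (G c x w (q m) * ∏ l ∈ (Finset.univ.image q).erase (q m), G c x (q m) l) *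
       (G c x (p i) (q m) * (∏ k, G c x (p (i.succAbove k)) (p i)) *
      (∏ l, H c x (p i) (q l)) * (∏ k, H c x (p (i.succAbove k)) (q m)) *
      Kp c x (fun k => p (i.succAbove k)) q) =
      ((∏ k, G c x (p (i.succAbove k)) (p i)) *
      (∏ l, H c x (p i) (q l)) * Kp c x (fun k => p (i.succAbove k)) q) *
      ∑ m : Fin n, G c x w (q m) * (∏ l ∈ (Finset.univ.image q).erase (q m), G c x (q m) l) *
        (G c x (p i) (q m) * ∏ k, H c x (p (i.succAbove k)) (q m)) := by
      rw [Finset.mul_sum]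
      exact Finset.sum_congr rfl fun m _ => by ring
    rw [this]
    linear_combination ((∏ k, G c x (p (i.succAbove k)) (p i)) *
      (∏ l, H c x (p i) (q l)) * Kp c x (fun k => p (i.succAbove k)) q) * hb
  rw [Finset.sum_congr rfl fun i _ => hterm i, Finset.sum_add_distrib, Finset.sum_comm]
  rw [add_eq_left]
  refine Finset.sum_eq_zero fun m _ => ?_
  rw [← Finset.mul_sum, lap_zero hg p q m (fun i => hpq i m), mul_zero]

/-- recursive form of the kernel -/
def KR (c : ℂ) (x : ι → ℂ) : List ι → Finset ι → ℂ
  | [], I => if I = ∅ then 1 else 0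
  | w :: l, I => ∑ i ∈ I, G c x i w * (l.map fun j => F c x i j).prod *
      (∏ k ∈ I.erase i, F c x k i) * KR c x l (I.erase i)

lemma KR_eq (hg : Good c x) : ∀ {n : ℕ} (p q : Fin n → ι) (_ : Function.Injective p)
    (_ : Function.Injective q) (_ : ∀ i j, p i ≠ q j),
    Kp c x p q = KR c x (List.ofFn q) (Finset.univ.image p) := by
  intro n
  induction n with
  | zero => intro p q _ _ _; simp [KR, Kp, vdm]
  | succ n ih =>
    intro p q hp hq hpq
    have hq' : Function.Injective (Fin.tail q) := hq.comp (Fin.succ_injective n)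
    have h1 := Kp_rec hg p (Fin.tail q) (q 0) hp hq' (fun i j => hpq i _) (fun i => hpq i 0)
      (fun j hh => Fin.succ_ne_zero j (hq hh))
    rw [Fin.cons_self_tail] at h1
    rw [h1, List.ofFn_succ, KR, Finset.sum_image (fun a _ b _ h => hp h)]
    refine Finset.sum_congr rfl fun i _ => ?_
    have hs : Function.Injective (fun k => p (i.succAbove k)) :=
      hp.comp Fin.succAbove_right_injective
    have he : (Finset.univ.image p).erase (p i) =
        Finset.univ.image (fun k => p (i.succAbove k)) := by
      ext y
      simp only [Finset.mem_erase, Finset.mem_image, Finset.mem_univ, true_and]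
      constructor
      · rintro ⟨h1, j, rfl⟩
        obtain ⟨k, hk⟩ := Fin.exists_succAbove_eq (x := j) (y := i) (fun hh => h1 (by rw [hh]))
        exact ⟨k, by rw [hk]⟩
      · rintro ⟨k, rfl⟩
        exact ⟨fun hh => Fin.succAbove_ne i k (hp hh), _, rfl⟩
    rw [he, Finset.prod_image (fun a _ b _ h => hs h), ih _ _ hs hq' (fun i j => hpq _ _),
      List.map_ofFn, List.prod_ofFn]
    rfl

lemma KR_card (l : List ι) : ∀ (I : Finset ι), I.card ≠ l.length → KR c x l I = 0 := by
  induction l with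
  | nil => intro I h; simp [KR]; simpa using h
  | cons w l ih =>
    intro I h
    rw [KR]
    refine Finset.sum_eq_zero fun i hi => ?_
    rw [ih, mul_zero]
    rw [Finset.card_erase_of_mem hi]
    have := Finset.card_pos.2 ⟨i, hi⟩
    simp at h
    omega

lemma KR_perm (hg : Good c x) {l l' : List ι} (h : l.Perm l') :
    l.Nodup → ∀ I : Finset ι, (∀ i ∈ I, i ∉ l) → KR c x l I = KR c x l' I := by
  induction h with
  | nil => intro _ _ _; rfl
  | cons w h ih =>
    intro hn I hI
    rw [KR, KR]
    refine Finset.sum_congr rfl fun i hi => ?_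
    rw [ih (List.nodup_cons.1 hn).2 _ (fun k hk hh =>
      hI k (Finset.mem_of_mem_erase hk) (List.mem_cons_of_mem _ hh)), (h.map _).prod_eq]
  | swap y w l =>
    intro hn I hI
    have hwy : w ≠ y := by
      intro e; subst e; simp at hn
    have expand : ∀ y w : ι, KR c x (w :: y :: l) I = ∑ i ∈ I, ∑ k ∈ I.erase i,
        G c x i w * F c x i y * G c x k y * F c x k i *
        ((l.map fun j => F c x i j).prod * (l.map fun j => F c x k j).prod *
          (∏ r ∈ (I.erase i).erase k, F c x r i) * (∏ r ∈ (I.erase i).erase k, F c x r k) *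
          KR c x l ((I.erase i).erase k)) := by
      intro y w
      simp only [KR]
      refine Finset.sum_congr rfl fun i _ => ?_
      rw [Finset.mul_sum]
      refine Finset.sum_congr rfl fun k hk => ?_
      rw [← Finset.mul_prod_erase (I.erase i) _ hk]
      simp only [List.map_cons, List.prod_cons]
      ring
    have hsym : ∀ Φ : ι → ι → ℂ, (2 : ℂ) * ∑ i ∈ I, ∑ k ∈ I.erase i, Φ i k =
        ∑ i ∈ I, ∑ k ∈ I.erase i, (Φ i k + Φ k i) := by
      intro Φ
      simp only [Finset.sum_add_distrib]
      rw [two_mul]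
      congr 1
      exact dswap I Φ
    refine mul_left_cancel₀ (two_ne_zero (α := ℂ)) ?_
    rw [expand, expand, hsym, hsym]
    refine Finset.sum_congr rfl fun i hi => Finset.sum_congr rfl fun k hk => ?_
    have hki : k ≠ i := Finset.ne_of_mem_erase hk
    have hkI := Finset.mem_of_mem_erase hk
    rw [Finset.erase_right_comm (a := k)]
    have hid : G c x i w * F c x i y * G c x k y * F c x k i +
        G c x k w * F c x k y * G c x i y * F c x i k =
        G c x i y * F c x i w * G c x k w * F c x k i +
        G c x k y * F c x k w * G c x i w * F c x i k := by
      have m1 : w ∈ w :: y :: l := by simp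
      have m2 : y ∈ w :: y :: l := by simp
      have s1 := sub_ne_zero.2 (hg.ne i w (fun hh => hI i hi (hh ▸ m1)))
      have s2 := sub_ne_zero.2 (hg.ne i y (fun hh => hI i hi (hh ▸ m2)))
      have s3 := sub_ne_zero.2 (hg.ne k w (fun hh => hI k hkI (hh ▸ m1)))
      have s4 := sub_ne_zero.2 (hg.ne k y (fun hh => hI k hkI (hh ▸ m2)))
      have s5 := sub_ne_zero.2 (hg.ne k i hki)
      unfold G F gg ff
      rw [← neg_sub (x k) (x i)]
      field_simp
      ring
    linear_combination ((l.map fun j => F c x i j).prod * (l.map fun j => F c x k j).prod *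
          (∏ r ∈ (I.erase i).erase k, F c x r i) * (∏ r ∈ (I.erase i).erase k, F c x r k) *
          KR c x l ((I.erase i).erase k)) * hid
  | trans h1 h2 ih1 ih2 =>
    intro hn I hI
    rw [ih1 hn I hI, ih2 (h1.nodup_iff.1 hn) I (fun i hi hh => hI i hi (h1.mem_iff.2 hh))]

/-- the kernel for finsets -/
def Kf (c : ℂ) (x : ι → ℂ) (I J : Finset ι) : ℂ := KR c x J.toList I

lemma Kf_empty (I : Finset ι) : Kf c x I ∅ = if I = ∅ then 1 else 0 := by
  simp [Kf, KR]

lemma Kf_insert (hg : Good c x) {I J : Finset ι} {w : ι} (hw : w ∉ J)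
    (hI : Disjoint I (insert w J)) :
    Kf c x I (insert w J) = ∑ i ∈ I, G c x i w * (∏ j ∈ J, F c x i j) *
      (∏ k ∈ I.erase i, F c x k i) * Kf c x (I.erase i) J := by
  rw [Kf, KR_perm hg (Finset.toList_insert hw) (Finset.nodup_toList _) _
    (fun i hi hh => Finset.disjoint_left.1 hI hi (Finset.mem_toList.1 hh)), KR]
  refine Finset.sum_congr rfl fun i _ => ?_
  rw [Finset.prod_map_toList, Kf]

end kernel

section right

variable {ι : Type*} [DecidableEq ι]
variable {c : ℂ} {x : ι → ℂ} {a b d e : ι → A}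

/-- coefficient on the right hand side -/
def cR (c : ℂ) (x : ι → ℂ) (U V I J : Finset ι) : ℂ :=
  Kf c x I J * dp (F c x) J (V \ J) * dp (G c x) (U \ I) I

/-- operator on the right hand side -/
def tR (c : ℂ) (x : ι → ℂ) (a b d e : ι → A) (U V I J : Finset ι) : A :=
  P (H c x) b I * P (H c x) a (U \ I) * P1 d (V \ J) * P1 e J

/-- right hand side -/
def Rf (c : ℂ) (x : ι → ℂ) (a b d e : ι → A) (U V : Finset ι) : A :=
  ∑ I ∈ U.powerset, ∑ J ∈ V.powerset, cR c x U V I J • tR c x a b d e U V I J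

lemma Rf_empty (U : Finset ι) : Rf c x a b d e U ∅ = P (H c x) a U := by
  rw [Rf, Finset.sum_eq_single ∅]
  · simp [cR, tR, dp, P1, P_empty, Kf_empty]
  · intro I _ hI
    simp [cR, Kf_empty, hI]
  · simp

lemma erase_sdiff_erase' {U I : Finset ι} {i : ι} (hi : i ∈ I) :
    U.erase i \ I.erase i = U \ I := by
  ext k; simp only [Finset.mem_sdiff, Finset.mem_erase]
  constructor
  · rintro ⟨⟨h1, h2⟩, h3⟩; exact ⟨h2, fun h4 => h3 ⟨h1, h4⟩⟩
  · rintro ⟨h1, h2⟩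
    exact ⟨⟨by rintro rfl; exact h2 hi, h1⟩, fun h3 => h2 h3.2⟩

lemma tR_move (h : Rel c x a b d e) {U V I J : Finset ι} {w : ι} (hJ : J ⊆ V) (hw : w ∉ V) :
    tR c x a b d e U V I J * d w = (∏ j ∈ J, F c x j w) • tR c x a b d e U (insert w V) I J +
      ∑ y ∈ J, (G c x w y * ∏ k ∈ J.erase y, F c x k y) •
        (tR c x a b d e U V I (J.erase y) * e w) := by
  have hwJ : w ∉ J := fun hh => hw (hJ hh)
  have e1 : insert w V \ J = insert w (V \ J) := Finset.insert_sdiff_of_notMem _ hwJ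
  have hw' : w ∉ V \ J := fun hh => hw (Finset.mem_sdiff.1 hh).1
  have e2 : ∀ y ∈ J, tR c x a b d e U V I (J.erase y) =
      P (H c x) b I * P (H c x) a (U \ I) * (P1 d (V \ J) * d y) * P1 e (J.erase y) := by
    intro y hy
    have : V \ J.erase y = insert y (V \ J) := by
      rw [Finset.sdiff_erase (hJ hy)]
    rw [tR, this, P1_insert h.dd (by simp [hy]), P1_comm h.dd]
  rw [Finset.sum_congr rfl fun y hy => by rw [e2 y hy]]
  rw [tR, tR, e1, P1_insert h.dd hw', P1_comm h.dd, mul_assoc _ (P1 e J), moveE h J w hwJ]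
  simp only [mul_add, mul_smul_comm, Finset.mul_sum, mul_assoc]

lemma tR_ins (h : Rel c x a b d e) {U V I J : Finset ι} {w : ι} (hJ : J ⊆ V) (hw : w ∉ V) :
    tR c x a b d e U (insert w V) I (insert w J) = tR c x a b d e U V I J * e w := by
  have hwJ : w ∉ J := fun hh => hw (hJ hh)
  have e1 : insert w V \ insert w J = V \ J := by
    rw [Finset.insert_sdiff_insert, Finset.sdiff_insert_of_notMem hw]
  rw [tR, e1, P1_insert h.ee hwJ, P1_comm h.ee, tR]
  simp only [mul_assoc]

lemma tR_b (h : Rel c x a b d e) {U V I J : Finset ι} {i : ι} (hi : i ∈ I) :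
    b i * tR c x a b d e (U.erase i) V (I.erase i) J =
      (∏ k ∈ I.erase i, H c x k i) • tR c x a b d e U V I J := by
  rw [tR, erase_sdiff_erase' hi, tR, ← mul_assoc, ← mul_assoc, ← mul_assoc,
    P_erase h.good h.bb hi]
  simp only [smul_mul_assoc]

lemma K_id (hg : Good c x) {V I J : Finset ι} {w : ι} (hJ : J ⊆ V)
    (hIV : Disjoint I V) (hwI : w ∉ I) (hw : w ∉ V) :
    Kf c x I (insert w J) * ∏ k ∈ V \ J, F c x w k =
      ∑ y ∈ V \ J, G c x w y * (∏ k ∈ (V \ J).erase y, F c x y k) * Kf c x I (insert y J) +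
      ∑ i ∈ I, G c x i w * (∏ j ∈ V \ J, F c x i j) * (∏ j ∈ J, F c x i j) *
        (∏ k ∈ I.erase i, F c x k i) * Kf c x (I.erase i) J := by
  have hwJ : w ∉ J := fun hh => hw (hJ hh)
  have hIJ : Disjoint I J := Finset.disjoint_of_subset_right hJ hIV
  have r1 := Kf_insert hg hwJ (I := I) (by rw [Finset.disjoint_insert_right]; exact ⟨hwI, hIJ⟩)
  have r2 : ∀ y ∈ V \ J,
      G c x w y * (∏ k ∈ (V \ J).erase y, F c x y k) * Kf c x I (insert y J) =
      ∑ i ∈ I, G c x w y * (∏ k ∈ (V \ J).erase y, F c x y k) * (G c x i y * (∏ j ∈ J, F c x i j) *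
      (∏ k ∈ I.erase i, F c x k i) * Kf c x (I.erase i) J) := by
    intro y hy
    obtain ⟨hyV, hyJ⟩ := Finset.mem_sdiff.1 hy
    rw [Kf_insert hg hyJ, Finset.mul_sum]
    rw [Finset.disjoint_insert_right]
    exact ⟨fun hh => Finset.disjoint_left.1 hIV hh hyV, hIJ⟩
  rw [r1, Finset.sum_congr rfl r2, Finset.sum_comm, ← Finset.sum_add_distrib, Finset.sum_mul]
  refine Finset.sum_congr rfl fun i hi => ?_
  have hp := pf1 hg (V \ J) i w
    (fun hh => Finset.disjoint_left.1 hIV hi (Finset.mem_sdiff.1 hh).1)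
    (fun hh => hw (Finset.mem_sdiff.1 hh).1) (ne_of_mem_notMem hi hwI)
  have : ∑ y ∈ V \ J, G c x w y * (∏ k ∈ (V \ J).erase y, F c x y k) *
      (G c x i y * (∏ j ∈ J, F c x i j) * (∏ k ∈ I.erase i, F c x k i) * Kf c x (I.erase i) J) =
      ((∏ j ∈ J, F c x i j) * (∏ k ∈ I.erase i, F c x k i) * Kf c x (I.erase i) J) *
      ∑ y ∈ V \ J, G c x w y * (G c x i y * ∏ k ∈ (V \ J).erase y, F c x y k) := by
    rw [Finset.mul_sum]
    exact Finset.sum_congr rfl fun y _ => by ring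
  rw [this]
  linear_combination ((∏ j ∈ J, F c x i j) * (∏ k ∈ I.erase i, F c x k i) *
    Kf c x (I.erase i) J) * hp

lemma cR_id (hg : Good c x) {U V I J : Finset ι} {w : ι} (hI : I ⊆ U) (hJ : J ⊆ V)
    (hUV : Disjoint U V) (hwU : w ∉ U) (hw : w ∉ V) :
    cR c x U (insert w V) I (insert w J) =
      ∑ y ∈ V \ J, (cR c x U V I (insert y J) * (G c x w y * ∏ k ∈ J, F c x k y)) +
      ∑ i ∈ I, gam c x w U V i * (cR c x (U.erase i) V (I.erase i) J *
        ∏ k ∈ I.erase i, H c x k i) := by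
  have hwJ : w ∉ J := fun hh => hw (hJ hh)
  have e1 : insert w V \ insert w J = V \ J := by
    rw [Finset.insert_sdiff_insert, Finset.sdiff_insert_of_notMem hw]
  have hk := K_id hg hJ (Finset.disjoint_of_subset_left hI hUV) (fun hh => hwU (hI hh)) hw
  have t1 : cR c x U (insert w V) I (insert w J) =
      (Kf c x I (insert w J) * ∏ k ∈ V \ J, F c x w k) *
        (dp (F c x) J (V \ J) * dp (G c x) (U \ I) I) := by
    rw [cR, e1, dp_insert_left _ _ hwJ]; ring
  rw [t1, hk, add_mul, Finset.sum_mul, Finset.sum_mul]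
  congr 1
  · refine Finset.sum_congr rfl fun y hy => ?_
    have hyJ := (Finset.mem_sdiff.1 hy).2
    rw [cR, Finset.sdiff_insert, dp_insert_left _ _ hyJ, dp_erase_right (F c x) J hy]
    ring
  · refine Finset.sum_congr rfl fun i hi => ?_
    have e2 := erase_sdiff_erase' (U := U) hi
    have e3 : ∏ k ∈ U.erase i, G c x k i =
        (∏ k ∈ U \ I, G c x k i) * ∏ k ∈ I.erase i, G c x k i := by
      rw [← e2, Finset.prod_sdiff (Finset.erase_subset_erase i hI)]
    rw [cR, e2, gam, e3, dp_erase_right (G c x) (U \ I) hi, ← GHp hg (I.erase i) i,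
      ← Finset.prod_sdiff hJ]
    ring

lemma Rv (h : Rel c x a b d e) {U V : Finset ι} {w : ι} (hUV : Disjoint U V) (hwU : w ∉ U)
    (hw : w ∉ V) :
    Rf c x a b d e U (insert w V) = Rf c x a b d e U V * d w +
      ∑ i ∈ U, gam c x w U V i • (b i * Rf c x a b d e (U.erase i) V * e w) := by
  have hg := h.good
  have s1 : Rf c x a b d e U V * d w = ∑ I ∈ U.powerset, ∑ J ∈ V.powerset,
      (cR c x U V I J * (∏ j ∈ J, F c x j w)) • tR c x a b d e U (insert w V) I J +
      ∑ I ∈ U.powerset, ∑ J ∈ V.powerset, ∑ y ∈ V \ J,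
        (cR c x U V I (insert y J) * (G c x w y * ∏ k ∈ J, F c x k y)) •
        (tR c x a b d e U V I J * e w) := by
    rw [Rf, Finset.sum_mul, ← Finset.sum_add_distrib]
    refine Finset.sum_congr rfl fun I _ => ?_
    rw [← reindex1, ← Finset.sum_add_distrib, Finset.sum_mul]
    refine Finset.sum_congr rfl fun J hJ => ?_
    rw [smul_mul_assoc, tR_move h (Finset.mem_powerset.1 hJ) hw, smul_add, smul_smul,
      Finset.smul_sum]
    congr 1
    refine Finset.sum_congr rfl fun y hy => ?_
    rw [Finset.insert_erase hy, smul_smul]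
  have s2 : ∑ i ∈ U, gam c x w U V i • (b i * Rf c x a b d e (U.erase i) V * e w) =
      ∑ I ∈ U.powerset, ∑ J ∈ V.powerset, ∑ i ∈ I,
        (gam c x w U V i * (cR c x (U.erase i) V (I.erase i) J *
        ∏ k ∈ I.erase i, H c x k i)) • (tR c x a b d e U V I J * e w) := by
    have : ∀ i ∈ U, gam c x w U V i • (b i * Rf c x a b d e (U.erase i) V * e w) =
        ∑ I ∈ (U.erase i).powerset, ∑ J ∈ V.powerset,
          (gam c x w U V i * cR c x (U.erase i) V I J) •
            (b i * tR c x a b d e (U.erase i) V I J * e w) := by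
      intro i _
      simp only [Rf, Finset.mul_sum, Finset.sum_mul, Finset.smul_sum, smul_smul, smul_mul_assoc,
        mul_smul_comm]
    rw [Finset.sum_congr rfl this, reindex3 U (fun i I => ∑ J ∈ V.powerset,
          (gam c x w U V i * cR c x (U.erase i) V I J) •
            (b i * tR c x a b d e (U.erase i) V I J * e w))]
    refine Finset.sum_congr rfl fun I _ => ?_
    rw [Finset.sum_comm]
    refine Finset.sum_congr rfl fun J _ => ?_
    refine Finset.sum_congr rfl fun i hi => ?_
    rw [tR_b h hi, smul_mul_assoc, smul_smul, mul_assoc]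
  rw [s1, s2, Rf, add_assoc, ← Finset.sum_add_distrib, ← Finset.sum_add_distrib]
  refine Finset.sum_congr rfl fun I hI => ?_
  rw [Finset.sum_powerset_insert hw]
  congr 1
  · refine Finset.sum_congr rfl fun J hJ => ?_
    have hwJ : w ∉ J := fun hh => hw (Finset.mem_powerset.1 hJ hh)
    have hw' : w ∉ V \ J := fun hh => hw (Finset.mem_sdiff.1 hh).1
    congr 1
    rw [cR, cR, Finset.insert_sdiff_of_notMem _ hwJ, dp_insert_right _ _ hw']
    ring
  · rw [← Finset.sum_add_distrib]
    refine Finset.sum_congr rfl fun J hJ => ?_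
    rw [tR_ins h (Finset.mem_powerset.1 hJ) hw,
      cR_id hg (Finset.mem_powerset.1 hI) (Finset.mem_powerset.1 hJ) hUV hwU hw, add_smul,
      Finset.sum_smul, Finset.sum_smul]

theorem Lf_eq_Rf (h : Rel c x a b d e) {U V : Finset ι} (hUV : Disjoint U V) :
    Lf c x a b d e U V = Rf c x a b d e U V := by
  refine uniq (c := c) (x := x) (b := b) (d := d) (e := e) (Lf c x a b d e) (Rf c x a b d e)
    (fun U => by rw [Lf_empty, Rf_empty]) ?_ ?_ V U hUV
  · intro V
    exact link h (Lf c x a b d e) (fun U => Lf_empty U)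
      (fun U V w h1 h2 h3 => Lv h h1 h2 h3) V
  · intro V U w h1 h2 h3
    exact Rv h h1 h2 h3

end right

section bridge

lemma rel_of_fam {ι : Type*} [DecidableEq ι] {c : ℂ} {x : ι → ℂ} (hg : Good c x)
    {T : Fin 3 → Fin 3 → ℂ → A} (hT : IsTFam c p12 T) :
    Rel c x (fun i => T 0 1 (x i)) (fun i => T 0 2 (x i)) (fun i => T 1 2 (x i))
      (fun i => T 1 1 (x i)) := by
  have hA : ∀ (q : Fin 3), p12 q = 1 → Exch (H c x) (fun i => T 0 q (x i)) := by
    intro q hq i j hij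
    have h1 := hT 0 q 0 q (x i) (x j) (hg.ne i j hij)
    have hp0 : p12 0 = 0 := rfl
    simp only [hq, hp0] at h1
    norm_num at h1
    have n1 := H_ne hg hij
    have n2 := H_ne hg hij.symm
    have n3 := G_ne hg hij
    have h2 : (G c x i j * H c x i j) • (T 0 q (x i) * T 0 q (x j)) =
        (G c x i j * H c x j i) • (T 0 q (x j) * T 0 q (x i)) := by
      have e1 : G c x i j * H c x i j = 1 + G c x i j := by rw [GH hg, F_eq hg hij]
      have e2 : G c x i j * H c x j i = G c x i j - 1 := by
        have := GH hg j i
        rw [F_eq hg hij.symm, G_anti c x i j] at this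
        linear_combination -this
      rw [e1, e2, add_smul, sub_smul, one_smul, one_smul]
      change _ = -(G c x i j • _) at h1
      rw [smul_sub] at h1
      rw [← sub_eq_zero] at h1 ⊢
      refine Eq.trans ?_ h1
      module
    beta_reduce
    rw [mul_smul, mul_smul] at h2
    have h3 := smul_right_injective A n3 h2
    beta_reduce at h3
    have h4 : T 0 q (x i) * T 0 q (x j) =
        ((H c x i j)⁻¹ * H c x j i) • (T 0 q (x j) * T 0 q (x i)) := by
      rw [mul_smul, ← h3, smul_smul, inv_mul_cancel₀ n1, one_smul]
    rw [h4, smul_smul]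
    congr 1
    field_simp
  have hD : ∀ (q : Fin 3), p12 q = 1 → ∀ i j, T 1 q (x i) * T 1 q (x j) =
      T 1 q (x j) * T 1 q (x i) := by
    intro q hq i j
    by_cases hij : i = j
    · rw [hij]
    have h1 := hT 1 q 1 q (x i) (x j) (hg.ne i j hij)
    have hp0 : p12 1 = 1 := rfl
    simp only [hq, hp0] at h1
    norm_num at h1
    have n1 := F_ne hg hij
    rw [F_eq hg hij] at n1
    change _ = -(G c x i j • _) at h1
    rw [← sub_eq_zero]
    refine (smul_eq_zero.1 ?_).resolve_left n1
    rw [← sub_eq_zero] at h1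
    refine Eq.trans ?_ h1
    module
  have hp0 : p12 0 = 0 := rfl
  have hp1 : p12 1 = 1 := rfl
  have hp2 : p12 2 = 1 := rfl
  refine ⟨hg, hA 1 rfl, hA 2 rfl, hD 2 rfl, hD 1 rfl, ?_, ?_, ?_, ?_, ?_⟩
  · intro w y hwy
    have h1 := hT 0 2 1 2 (x y) (x w) (hg.ne y w hwy.symm)
    simp only [hp0, hp1, hp2] at h1
    norm_num at h1
    change _ = -(G c x y w • _) at h1
    rw [F_eq hg hwy.symm, G_anti c x y w]
    rw [← sub_eq_zero] at h1 ⊢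
    refine Eq.trans ?_ (neg_eq_zero.2 h1)
    module
  · intro y w hyw
    have h1 := hT 1 1 1 2 (x y) (x w) (hg.ne y w hyw)
    simp only [hp0, hp1, hp2] at h1
    norm_num at h1
    change _ = -(G c x y w • _) at h1
    rw [F_eq hg hyw, G_anti c x y w]
    rw [← sub_eq_zero] at h1 ⊢
    refine Eq.trans ?_ h1
    module
  · intro w z hwz
    have h1 := hT 0 1 1 2 (x z) (x w) (hg.ne z w hwz.symm)
    simp only [hp0, hp1, hp2] at h1
    norm_num at h1
    change _ = -(G c x z w • _) at h1
    rw [← sub_eq_zero] at h1 ⊢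
    refine Eq.trans ?_ (neg_eq_zero.2 h1)
    module
  · intro w z hwz
    have h1 := hT 0 1 1 1 (x z) (x w) (hg.ne z w hwz.symm)
    simp only [hp0, hp1, hp2] at h1
    norm_num at h1
    change _ = -(G c x z w • _) at h1
    rw [F_eq hg hwz.symm, G_anti c x z w]
    rw [← sub_eq_zero] at h1 ⊢
    refine Eq.trans ?_ (neg_eq_zero.2 h1)
    module
  · intro z y hzy
    have h1 := hT 0 1 0 2 (x z) (x y) (hg.ne z y hzy)
    simp only [hp0, hp1, hp2] at h1
    norm_num at h1
    change _ = -(G c x z y • _) at h1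
    rw [F_eq hg hzy.symm, G_anti c x z y]
    rw [← sub_eq_zero] at h1 ⊢
    refine Eq.trans ?_ h1
    module

variable {ι : Type*} [DecidableEq ι] {c : ℂ} {x : ι → ℂ}

lemma TT_map (T : ℂ → A) (L : List ι) :
    TT c T (L.map x) = PL (H c x) (fun i => T (x i)) L := by
  induction L with
  | nil => simp [TT, Hnorm, Tprod, PL]
  | cons i L ih =>
    rw [PL, ← ih]
    simp only [TT, Tprod, List.map_cons, Hnorm, List.prod_cons, mul_smul_comm, smul_smul, mul_inv,
      List.map_map]
    rfl

lemma Tprod_map (T : ℂ → A) (L : List ι) :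
    Tprod T (L.map x) = PL (fun _ _ => 1) (fun i => T (x i)) L := by
  induction L with
  | nil => simp [Tprod, PL]
  | cons i L ih =>
    rw [PL, ← ih]
    simp [Tprod]

/-- positions as indices -/
def ixs {n : ℕ} (f : Fin n ↪ ι) (S : Finset (Fin n)) : List ι := (S.sort (· ≤ ·)).map f

lemma ixs_nodup {n : ℕ} (f : Fin n ↪ ι) (S : Finset (Fin n)) : (ixs f S).Nodup :=
  (Finset.sort_nodup _ _).map f.injective

lemma mem_ixs {n : ℕ} (f : Fin n ↪ ι) (S : Finset (Fin n)) (i : ι) :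
    i ∈ ixs f S ↔ i ∈ S.map f := by
  simp [ixs]

lemma ixs_perm {n : ℕ} (f : Fin n ↪ ι) (S : Finset (Fin n)) :
    (ixs f S).Perm (S.map f).toList := by
  rw [List.perm_ext_iff_of_nodup (ixs_nodup f S) (Finset.nodup_toList _)]
  intro i; rw [mem_ixs, Finset.mem_toList]

lemma ixs_length {n : ℕ} (f : Fin n ↪ ι) (S : Finset (Fin n)) : (ixs f S).length = S.card := by
  simp [ixs]

lemma ixs_toFinset {n : ℕ} (f : Fin n ↪ ι) (S : Finset (Fin n)) :
    (ixs f S).toFinset = S.map f := by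
  ext i; rw [List.mem_toFinset, mem_ixs]

lemma sel_eq {l : List ℂ} (f : Fin l.length ↪ ι) (hx : ∀ i, x (f i) = l.get i)
    (S : Finset (Fin l.length)) : sel l S = (ixs f S).map x := by
  rw [sel, ixs, List.map_map]
  refine List.map_congr_left fun i _ => (hx i).symm

lemma ixs_prod {n : ℕ} (f : Fin n ↪ ι) (S : Finset (Fin n)) (ψ : ι → ℂ) :
    ((ixs f S).map ψ).prod = ∏ i ∈ S.map f, ψ i := by
  rw [((ixs_perm f S).map ψ).prod_eq, Finset.prod_map_toList]

lemma prodGG_ixs {n m : ℕ} (f : Fin n ↪ ι) (f' : Fin m ↪ ι) (S : Finset (Fin n))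
    (Q : Finset (Fin m)) :
    prodGG c ((ixs f S).map x) ((ixs f' Q).map x) = dp (G c x) (S.map f) (Q.map f') := by
  rw [prodGG, dp, List.map_map, ← ixs_prod]
  congr 1
  refine List.map_congr_left fun i _ => ?_
  simp only [Function.comp, List.map_map]
  exact ixs_prod f' Q (fun j => G c x i j)

lemma prodFF_ixs {n m : ℕ} (f : Fin n ↪ ι) (f' : Fin m ↪ ι) (S : Finset (Fin n))
    (Q : Finset (Fin m)) :
    prodFF c ((ixs f S).map x) ((ixs f' Q).map x) = dp (F c x) (S.map f) (Q.map f') := by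
  rw [prodFF, dp, List.map_map, ← ixs_prod]
  congr 1
  refine List.map_congr_left fun i _ => ?_
  simp only [Function.comp, List.map_map]
  exact ixs_prod f' Q (fun j => F c x i j)

lemma TT_ixs {n : ℕ} (f : Fin n ↪ ι) (S : Finset (Fin n)) (T : ℂ → A)
    (hE : Exch (H c x) (fun i => T (x i))) :
    TT c T ((ixs f S).map x) = P (H c x) (fun i => T (x i)) (S.map f) := by
  rw [TT_map, PL_perm hE (ixs_perm f S) (ixs_nodup f S), P]

lemma Tprod_ixs {n : ℕ} (f : Fin n ↪ ι) (S : Finset (Fin n)) (T : ℂ → A)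
    (hE : ∀ i j, T (x i) * T (x j) = T (x j) * T (x i)) :
    Tprod T ((ixs f S).map x) = P1 (fun i => T (x i)) (S.map f) := by
  rw [Tprod_map, PL_perm (P1_exch hE) (ixs_perm f S) (ixs_nodup f S), P1, P]

lemma prodHHne_map (L : List ι) (hL : L.Nodup) :
    prodHHne c (L.map x) = hne c x L.toFinset := by
  let p : Fin (L.map x).length → ι := fun j => L.get (j.cast (by simp))
  have hp : Function.Injective p := by
    intro i j h
    have := hL.injective_get h
    exact Fin.cast_injective _ this
  have him : Finset.univ.image p = L.toFinset := by
    ext i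
    simp only [Finset.mem_image, Finset.mem_univ, true_and, List.mem_toFinset, List.mem_iff_get]
    constructor
    · rintro ⟨j, rfl⟩; exact ⟨_, rfl⟩
    · rintro ⟨j, rfl⟩; exact ⟨j.cast (by simp), rfl⟩
  rw [hne, ← him, Finset.prod_image (fun a _ b _ h => hp h), prodHHne]
  refine Finset.prod_congr rfl fun j _ => ?_
  rw [← Finset.image_erase hp, Finset.prod_image (fun a _ b _ h => hp h)]
  have : Finset.univ.erase j = Finset.univ.filter (fun k => j ≠ k) := by
    ext k; simp [eq_comm]
  rw [this, Finset.prod_filter]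
  refine Finset.prod_congr rfl fun k _ => ?_
  simp [p, H]

lemma KizL_map (hg : Good c x) (L L' : List ι) (hL : L.Nodup) (hL' : L'.Nodup)
    (hd : ∀ i ∈ L, i ∉ L') (hlen : L.length = L'.length) :
    KizL c (L.map x) (L'.map x) = KR c x L' L.toFinset := by
  have hlen' : (L.map x).length = (L'.map x).length := by simpa using hlen
  let p : Fin (L.map x).length → ι := fun j => L.get (j.cast (by simp))
  let q : Fin (L.map x).length → ι := fun j => L'.get (j.cast (by simpa using hlen))
  have hp : Function.Injective p := by
    intro i j h
    have := hL.injective_get h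
    exact Fin.cast_injective _ this
  have hq : Function.Injective q := by
    intro i j h
    have := hL'.injective_get h
    exact Fin.cast_injective _ this
  have him : Finset.univ.image p = L.toFinset := by
    ext i
    simp only [Finset.mem_image, Finset.mem_univ, true_and, List.mem_toFinset, List.mem_iff_get]
    constructor
    · rintro ⟨j, rfl⟩; exact ⟨_, rfl⟩
    · rintro ⟨j, rfl⟩; exact ⟨j.cast (by simp), rfl⟩
  have hof : List.ofFn q = L' := by
    refine List.ext_getElem (by simpa using hlen) ?_
    intro i h1 h2
    simp [q]
  rw [KizL, dif_pos hlen']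
  have h1 : (L.map x).get = fun j => x (p j) := by
    funext j; simp [p]
  have h2 : (fun j : Fin (L.map x).length => (L'.map x).get (Fin.cast hlen' j)) =
      fun j => x (q j) := by
    funext j; simp [q]
  rw [h2, h1, Kiz_eq_Kp, KR_eq hg p q hp hq, him, hof]
  intro i j hh
  exact hd (p i) (List.get_mem _ _) (hh ▸ List.get_mem _ _)

lemma sum_powerset_map {α B : Type*} [Fintype α] [DecidableEq α] [AddCommMonoid B]
    (f : α ↪ ι) (φ : Finset ι → B) :
    ∑ I ∈ (Finset.univ.map f).powerset, φ I = ∑ S : Finset α, φ (S.map f) := by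
  symm
  refine Finset.sum_bij (fun S _ => S.map f) ?_ ?_ ?_ ?_
  · intro S _
    exact Finset.mem_powerset.2 (Finset.map_subset_map.2 (Finset.subset_univ S))
  · intro S _ S' _ h
    exact Finset.map_injective f h
  · intro I hI
    refine ⟨Finset.univ.filter (fun i => f i ∈ I), Finset.mem_univ _, ?_⟩
    ext k
    simp only [Finset.mem_map, Finset.mem_filter, Finset.mem_univ, true_and]
    constructor
    · rintro ⟨i, hi, rfl⟩; exact hi
    · intro hk
      have := Finset.mem_powerset.1 hI hk
      simp only [Finset.mem_map, Finset.mem_univ, true_and] at this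
      obtain ⟨i, rfl⟩ := this
      exact ⟨i, hk, rfl⟩
  · intro S _; rfl

lemma map_compl {α : Type*} [Fintype α] [DecidableEq α] (f : α ↪ ι) (S : Finset α) :
    Finset.univ.map f \ S.map f = Sᶜ.map f := by
  rw [Finset.compl_eq_univ_sdiff, Finset.map_sdiff]

lemma PL_act {M : Type*} [AddCommGroup M] [Module ℂ M] [Module A M] [IsScalarTower ℂ A M]
    (T : ι → A) (lam : ι → ℂ) (Ω : M) (h : ∀ i, T i • Ω = lam i • Ω) (L : List ι) :
    PL (fun _ _ => 1) T L • Ω = (L.map lam).prod • Ω := by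
  induction L with
  | nil => simp [PL]
  | cons i L ih =>
    simp only [PL, List.map_cons, List.prod_cons]
    simp only [List.map_const', List.prod_replicate, one_pow, inv_one, one_smul]
    rw [mul_smul, ih, smul_comm, h, smul_smul, mul_comm]

lemma P1_act {M : Type*} [AddCommGroup M] [Module ℂ M] [Module A M] [IsScalarTower ℂ A M]
    (T : ι → A) (lam : ι → ℂ) (Ω : M) (h : ∀ i, T i • Ω = lam i • Ω) (S : Finset ι) :
    P1 T S • Ω = (∏ i ∈ S, lam i) • Ω := by
  rw [P1, P, PL_act T lam Ω h, Finset.prod_map_toList]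

lemma good_of_adm (hc : c ≠ 0) {u v : List ℂ} (hadm : Admissible c (u ++ v)) :
    Good c (Sum.elim u.get v.get : Fin u.length ⊕ Fin v.length → ℂ) := by
  obtain ⟨h1, h2, h3⟩ := List.pairwise_append.1 hadm
  rw [List.pairwise_iff_get] at h1 h2
  have key : ∀ i j : Fin u.length ⊕ Fin v.length, i ≠ j →
      Sum.elim u.get v.get i ≠ Sum.elim u.get v.get j ∧
      Sum.elim u.get v.get i - Sum.elim u.get v.get j + c ≠ 0 := by
    rintro (i | i) (j | j) hij
    · have hij' : i ≠ j := fun hh => hij (by rw [hh])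
      rcases lt_or_gt_of_ne hij' with h | h
      · exact ⟨(h1 i j h).1, (h1 i j h).2.1⟩
      · exact ⟨(h1 j i h).1.symm, (h1 j i h).2.2⟩
    · have := h3 _ (List.get_mem u i) _ (List.get_mem v j)
      exact ⟨this.1, this.2.1⟩
    · have := h3 _ (List.get_mem u j) _ (List.get_mem v i)
      exact ⟨this.1.symm, this.2.2⟩
    · have hij' : i ≠ j := fun hh => hij (by rw [hh])
      rcases lt_or_gt_of_ne hij' with h | h
      · exact ⟨(h2 i j h).1, (h2 i j h).2.1⟩
      · exact ⟨(h2 j i h).1.symm, (h2 j i h).2.2⟩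
  exact ⟨hc, fun i j h => (key i j h).1, fun i j h => (key i j h).2⟩

end bridge

section final

variable {M : Type*} [AddCommGroup M] [Module ℂ M] [Module A M] [IsScalarTower ℂ A M]
variable {ι : Type*} [DecidableEq ι] {c : ℂ} {x : ι → ℂ}

lemma lamP_ixs {n : ℕ} (f : Fin n ↪ ι) (S : Finset (Fin n)) (lam : ℂ → ℂ) :
    lamP lam ((ixs f S).map x) = ∏ i ∈ S.map f, lam (x i) := by
  rw [lamP, List.map_map, ixs_prod]; rfl

lemma smul_shift (k l : ℂ) (X : A) (Ω : M) : (k * l) • X • Ω = k • X • l • Ω := by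
  rw [mul_smul, smul_comm X l]

lemma PhiTA_act {T : Fin 3 → Fin 3 → ℂ → A} {lam : ℂ → ℂ} {Ω : M}
    (hR : Rel c x (fun i => T 0 1 (x i)) (fun i => T 0 2 (x i)) (fun i => T 1 2 (x i))
      (fun i => T 1 1 (x i))) (hw : ∀ z, T 1 1 z • Ω = lam z • Ω) (u v : List ℂ)
    (fu : Fin u.length ↪ ι) (fv : Fin v.length ↪ ι)
    (hu : ∀ i, x (fu i) = u.get i) (hv : ∀ i, x (fv i) = v.get i) :
    PhiTA c T lam u v • Ω = Lf c x (fun i => T 0 1 (x i)) (fun i => T 0 2 (x i))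
      (fun i => T 1 2 (x i)) (fun i => T 1 1 (x i)) (Finset.univ.map fu) (Finset.univ.map fv)
      • Ω := by
  rw [PhiTA, Lf, sum_powerset_map, Finset.sum_smul, Finset.sum_smul]
  refine Finset.sum_congr rfl fun S _ => ?_
  rw [sum_powerset_map, Finset.sum_smul, Finset.sum_smul]
  refine Finset.sum_congr rfl fun Q _ => ?_
  rw [cL, tL, Finset.card_map, Finset.card_map, map_compl, map_compl]
  by_cases h : S.card = Q.card
  · rw [if_pos h, if_pos h, sel_eq fu hu, sel_eq fv hv, sel_eq fu hu, sel_eq fv hv, prodGG_ixs,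
      prodFF_ixs, prodGG_ixs, prodHHne_map _ (ixs_nodup fv Q), ixs_toFinset, lamP_ixs,
      TT_ixs fv Q (T 0 2) hR.bb, TT_ixs fu Sᶜ (T 0 1) hR.aa, Tprod_ixs fv Qᶜ (T 1 2) hR.dd,
      smul_assoc, smul_assoc, mul_smul (P _ _ _ * P1 _ _ * P _ _ _ : A) (P1 _ _) Ω,
      P1_act (fun i => T 1 1 (x i)) (fun i => lam (x i)) Ω (fun i => hw (x i)), smul_shift]
  · rw [if_neg h, if_neg h, zero_smul, zero_smul, zero_smul]

lemma PhiTB_act {T : Fin 3 → Fin 3 → ℂ → A} {lam : ℂ → ℂ} {Ω : M}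
    (hR : Rel c x (fun i => T 0 1 (x i)) (fun i => T 0 2 (x i)) (fun i => T 1 2 (x i))
      (fun i => T 1 1 (x i))) (hw : ∀ z, T 1 1 z • Ω = lam z • Ω) (u v : List ℂ)
    (fu : Fin u.length ↪ ι) (fv : Fin v.length ↪ ι)
    (hu : ∀ i, x (fu i) = u.get i) (hv : ∀ i, x (fv i) = v.get i)
    (hd : ∀ i j, fu i ≠ fv j) :
    PhiTB c T lam u v • Ω = Rf c x (fun i => T 0 1 (x i)) (fun i => T 0 2 (x i))
      (fun i => T 1 2 (x i)) (fun i => T 1 1 (x i)) (Finset.univ.map fu) (Finset.univ.map fv)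
      • Ω := by
  rw [PhiTB, Rf, sum_powerset_map, Finset.sum_smul, Finset.sum_smul]
  refine Finset.sum_congr rfl fun S _ => ?_
  rw [sum_powerset_map, Finset.sum_smul, Finset.sum_smul]
  refine Finset.sum_congr rfl fun Q _ => ?_
  rw [cR, tR, map_compl, map_compl]
  have hdis : ∀ i ∈ S.map fu, i ∉ Q.map fv := by
    intro i hi hj
    obtain ⟨a, _, rfl⟩ := Finset.mem_map.1 hi
    obtain ⟨b, _, hb⟩ := Finset.mem_map.1 hj
    exact hd a b hb.symm
  by_cases h : S.card = Q.card
  · have hK : KizL c ((ixs fu S).map x) ((ixs fv Q).map x) = Kf c x (S.map fu) (Q.map fv) := by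
      rw [KizL_map hR.good _ _ (ixs_nodup _ _) (ixs_nodup _ _) (by
        intro i hi; rw [mem_ixs] at hi ⊢; exact hdis i hi) (by rw [ixs_length, ixs_length, h]),
        ixs_toFinset, Kf]
      exact KR_perm hR.good (ixs_perm fv Q) (ixs_nodup _ _) _
        (fun i hi => by rw [mem_ixs]; exact hdis i hi)
    rw [if_pos h, sel_eq fu hu, sel_eq fv hv, sel_eq fu hu, sel_eq fv hv, hK, prodGG_ixs,
      prodFF_ixs, lamP_ixs,
      TT_ixs fu S (T 0 2) hR.bb, TT_ixs fu Sᶜ (T 0 1) hR.aa, Tprod_ixs fv Qᶜ (T 1 2) hR.dd,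
      smul_assoc, smul_assoc, mul_smul (P _ _ _ * P _ _ _ * P1 _ _ : A) (P1 _ _) Ω,
      P1_act (fun i => T 1 1 (x i)) (fun i => lam (x i)) Ω (fun i => hw (x i)), smul_shift]
  · rw [if_neg h, Kf, KR_card _ _ (by simpa using h)]
    simp

end final

/-- the two explicit expressions for the `Y(1|2)` Bethe vector agree. -/
theorem statement11 {M : Type*} [AddCommGroup M] [Module ℂ M] [Module A M]
    [IsScalarTower ℂ A M]
    (c : ℂ) (hc : c ≠ 0) (T : Fin 3 → Fin 3 → ℂ → A)
    (hT : IsTFam c p12 T) (lam : Fin 3 → ℂ → ℂ) (Ω : M)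
    (hw0 : ∀ i j : Fin 3, j < i → ∀ z : ℂ, T i j z • Ω = 0)
    (hw1 : ∀ i : Fin 3, ∀ z : ℂ, T i i z • Ω = lam i z • Ω)
    (u v : List ℂ) (hadm : Admissible c (u ++ v)) :
    PhiTA c T (lam 1) u v • Ω = PhiTB c T (lam 1) u v • Ω := by
  have hg := good_of_adm hc hadm
  have hR := rel_of_fam hg hT
  rw [PhiTA_act hR (hw1 1) u v Function.Embedding.inl Function.Embedding.inr
      (fun _ => rfl) (fun _ => rfl),
    PhiTB_act hR (hw1 1) u v Function.Embedding.inl Function.Embedding.inr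
      (fun _ => rfl) (fun _ => rfl) (fun _ _ => Sum.inl_ne_inr), Lf_eq_Rf hR]
  rw [Finset.disjoint_left]
  intro i hi hj
  obtain ⟨a, _, rfl⟩ := Finset.mem_map.1 hi
  obtain ⟨b, _, hb⟩ := Finset.mem_map.1 hj
  exact Sum.inl_ne_inr hb.symm

end Bethe
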